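/- arXiv:1812.00916 — 4 statements merged into one kernel-verified Lean document; each statement's English description precedes it below -/
import Mathlib

section
/- The sequence w_s(d)/d converges in [0,∞] as d → ∞, and its limit equals sup_{d≥1} w_s(d)/d; likewise the sequence w_p(d)/d converges in [0,∞] as d → ∞, and its limit equals sup_{d≥1} w_p(d)/d. -/
open Set ENNReal Filter

/-- The lattice width of a set `K ⊆ ℝ^ι` with respect to the integer lattice `ℤ^ι`. -/
noncomputable def latticeWidth {ι : Type*} (K : Set (ι → ℝ)) : ℝ :=
  sInf { w : ℝ | ∃ f : (ι → ℝ) →ₗ[ℝ] ℝ,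
    (∀ v : ι → ℤ, ∃ k : ℤ, f (fun i => (v i : ℝ)) = (k : ℝ)) ∧ f ≠ 0 ∧
    w = sSup (f '' K) - sInf (f '' K) }


/-- `w_p(n)`: the supremum in `[0,∞]` of the lattice widths of all hollow lattice
`n`-polytopes. -/
noncomputable def wp (n : ℕ) : ℝ≥0∞ :=
  ⨆ (V : Finset (Fin n → ℝ)) (_ : ∀ v ∈ V, ∀ i, ∃ k : ℤ, v i = (k : ℝ))
    (_ : (interior (convexHull ℝ (V : Set (Fin n → ℝ)))).Nonempty)
    (_ : ∀ z : Fin n → ℤ,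
      (fun i => (z i : ℝ)) ∉ interior (convexHull ℝ (V : Set (Fin n → ℝ)))),
    ENNReal.ofReal (latticeWidth (convexHull ℝ (V : Set (Fin n → ℝ))))

/-- `w_s(n)`: the supremum in `[0,∞]` of the lattice widths of all hollow lattice
`n`-simplices. -/
noncomputable def ws (n : ℕ) : ℝ≥0∞ :=
  ⨆ (v : Fin (n + 1) → (Fin n → ℝ)) (_ : AffineIndependent ℝ v)
    (_ : ∀ j i, ∃ k : ℤ, v j i = (k : ℝ))
    (_ : ∀ z : Fin n → ℤ,
      (fun i => (z i : ℝ)) ∉ interior (convexHull ℝ (Set.range v))),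
    ENNReal.ofReal (latticeWidth (convexHull ℝ (Set.range v)))

/-- `f` takes integer values on the integer lattice. -/
def IsIntegerFunctional {ι : Type*} (f : (ι → ℝ) →ₗ[ℝ] ℝ) : Prop :=
  ∀ v : ι → ℤ, ∃ k : ℤ, f (fun i => (v i : ℝ)) = (k : ℝ)

/-- There is a hollow lattice polytope in `ℝ^ι` of lattice width at least `w` which is the convex
hull of at most `k` lattice points. -/
def HasHollowPolytope (ι : Type*) [Fintype ι] (k : ℕ) (w : ℝ) : Prop :=
  ∃ V : Finset (ι → ℝ), (∀ v ∈ V, ∀ i, ∃ k : ℤ, v i = (k : ℝ)) ∧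
    (interior (convexHull ℝ (V : Set (ι → ℝ)))).Nonempty ∧
    (∀ z : ι → ℤ, (fun i => (z i : ℝ)) ∉ interior (convexHull ℝ (V : Set (ι → ℝ)))) ∧
    V.card ≤ k ∧ w ≤ latticeWidth (convexHull ℝ (V : Set (ι → ℝ)))

section Width

variable {ι : Type*} [Fintype ι] {K : Set (ι → ℝ)}

theorem sub_le_sSup_image_sub_sInf_image (hK : IsCompact K) (f : (ι → ℝ) →ₗ[ℝ] ℝ)
    {x y : ι → ℝ} (hx : x ∈ K) (hy : y ∈ K) : f x - f y ≤ sSup (f '' K) - sInf (f '' K) := by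
  have hc : IsCompact (f '' K) := hK.image f.continuous_of_finiteDimensional
  exact sub_le_sub (le_csSup hc.bddAbove ⟨x, hx, rfl⟩) (csInf_le hc.bddBelow ⟨y, hy, rfl⟩)

theorem exists_latticeWidth_le_sub (hK : IsCompact K) (hne : K.Nonempty)
    {f : (ι → ℝ) →ₗ[ℝ] ℝ} (hf : IsIntegerFunctional f) (hf0 : f ≠ 0) :
    ∃ x ∈ K, ∃ y ∈ K, latticeWidth K ≤ f x - f y := by
  have hc : IsCompact (f '' K) := hK.image f.continuous_of_finiteDimensional
  obtain ⟨x, hx, hfx⟩ := hc.sSup_mem (hne.image f)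
  obtain ⟨y, hy, hfy⟩ := hc.sInf_mem (hne.image f)
  refine ⟨x, hx, y, hy, ?_⟩
  rw [hfx, hfy]
  refine csInf_le ⟨0, ?_⟩ ⟨f, hf, hf0, rfl⟩
  rintro _ ⟨g, -, -, rfl⟩
  simpa using sub_le_sSup_image_sub_sInf_image hK g hx hx

theorem le_latticeWidth [Nonempty ι] (hK : IsCompact K) {w : ℝ}
    (h : ∀ f : (ι → ℝ) →ₗ[ℝ] ℝ, IsIntegerFunctional f → f ≠ 0 →
      ∃ x ∈ K, ∃ y ∈ K, w ≤ f x - f y) : w ≤ latticeWidth K := by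
  classical
  refine le_csInf ?_ ?_
  · obtain ⟨i⟩ := ‹Nonempty ι›
    refine ⟨_, LinearMap.proj i, fun v => ⟨v i, rfl⟩, fun h0 => ?_, rfl⟩
    simpa using LinearMap.congr_fun h0 (Pi.single i 1)
  · rintro _ ⟨f, hf, hf0, rfl⟩
    obtain ⟨x, hx, y, hy, hxy⟩ := h f hf hf0
    exact hxy.trans (sub_le_sSup_image_sub_sInf_image hK f hx hy)

end Width

/-- The coordinate identification `(ℝ^ι)^m ≃ ℝ^κ` induced by `m × ι ≃ κ`. -/
noncomputable def blockEquiv {α ι κ : Type*} (e : α × ι ≃ κ) :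
    (α → ι → ℝ) ≃ₗ[ℝ] (κ → ℝ) :=
  (LinearEquiv.curry ℝ ℝ α ι).symm.trans (LinearEquiv.funCongrLeft ℝ ℝ e.symm)

theorem blockEquiv_apply {α ι κ : Type*} (e : α × ι ≃ κ) (g : α → ι → ℝ) (k : κ) :
    blockEquiv e g k = g (e.symm k).1 (e.symm k).2 := rfl

open scoped Pointwise in
/-- The dilated direct sum of `m` copies of a polytope about one of its vertices. -/
theorem HasHollowPolytope.directSum {α ι κ : Type*} [Fintype α] [Fintype ι] [Fintype κ]
    [Nonempty α] [Nonempty ι] (e : α × ι ≃ κ) {k : ℕ} {w : ℝ} (h : HasHollowPolytope ι k w) :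
    HasHollowPolytope κ (Fintype.card α * (k - 1) + 1) (Fintype.card α * w) := by
  classical
  obtain ⟨V, hV, ⟨c, hc⟩, hhol, hcard, hw⟩ := h
  have hVne : V.Nonempty := by
    rw [← Finset.coe_nonempty, ← convexHull_nonempty_iff (𝕜 := ℝ)]
    exact ⟨c, interior_subset hc⟩
  obtain ⟨v₀, hv₀⟩ := hVne
  set K := convexHull ℝ (V : Set (ι → ℝ))
  have hKc : Convex ℝ K := convex_convexHull ℝ _
  have hVK : (V : Set (ι → ℝ)) ⊆ K := subset_convexHull ℝ _
  have hKcomp : IsCompact K := V.finite_toSet.isCompact_convexHull ℝ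
  set m : ℕ := Fintype.card α with hm
  have hm0 : (0 : ℝ) < m := by exact_mod_cast Fintype.card_pos
  set T := blockEquiv e with hT
  set b : κ → ℝ := T fun _ => v₀ with hb
  let q : α → (ι → ℝ) → (κ → ℝ) := fun j x => b + (m : ℝ) • T (Pi.single j (x - v₀))
  let W : Finset (κ → ℝ) :=
    insert b ((Finset.univ ×ˢ V.erase v₀).image fun p => q p.1 p.2)
  have hqW : ∀ j, ∀ v ∈ V, q j v ∈ W := by
    intro j v hv
    by_cases hvv : v = v₀
    · simp [W, q, hvv]
    · refine Finset.mem_insert_of_mem (Finset.mem_image.2 ⟨(j, v), ?_, rfl⟩)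
      simp [hv, hvv]
  have hWq : ∀ y ∈ W, ∃ j, ∃ v ∈ V, y = q j v := by
    intro y hy
    rcases Finset.mem_insert.1 hy with rfl | hy
    · exact ⟨Classical.arbitrary α, v₀, hv₀, by simp [q]⟩
    · obtain ⟨⟨j, v⟩, hp, rfl⟩ := Finset.mem_image.1 hy
      simp only [Finset.mem_product, Finset.mem_erase] at hp
      exact ⟨j, v, hp.2.2, rfl⟩
  set P := convexHull ℝ (W : Set (κ → ℝ))
  have hPc : Convex ℝ P := convex_convexHull ℝ _
  have hPcomp : IsCompact P := W.finite_toSet.isCompact_convexHull ℝ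
  have hqP : ∀ j, ∀ x ∈ K, q j x ∈ P := by
    intro j x hx
    have haff : ∃ A : (ι → ℝ) →ᵃ[ℝ] (κ → ℝ), ∀ x, A x = q j x := by
      refine ⟨AffineMap.const ℝ _ (b - (m : ℝ) • T (Pi.single j v₀)) +
        ((m : ℝ) • (T.toLinearMap ∘ₗ LinearMap.single ℝ (fun _ => ι → ℝ) j)).toAffineMap,
        fun x => ?_⟩
      simp only [q, AffineMap.coe_add, Pi.add_apply, AffineMap.const_apply,
        LinearMap.coe_toAffineMap, LinearMap.smul_apply, LinearMap.comp_apply,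
        LinearEquiv.coe_coe, LinearMap.coe_single, Pi.single_sub, map_sub, smul_sub]
      abel
    obtain ⟨A, hA⟩ := haff
    have hsub : K ⊆ A ⁻¹' P := by
      refine convexHull_min (fun v hv => ?_) (hPc.affine_preimage A)
      rw [mem_preimage, hA]
      exact subset_convexHull ℝ _ (hqW j v hv)
    rw [← hA]
    exact hsub hx
  have hbox : ∀ y, (∀ j, T.symm y j ∈ K) → y ∈ P := by
    intro y hy
    have hsum : y = ∑ j : α, (1 / (m : ℝ)) • q j (T.symm y j) := by
      simp only [q, smul_add, Finset.sum_add_distrib, smul_smul]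
      rw [one_div, inv_mul_cancel₀ hm0.ne']
      simp only [one_smul, ← map_sum]
      rw [Finset.sum_const, Finset.card_univ, ← hm, ← Nat.cast_smul_eq_nsmul ℝ, smul_smul,
        mul_inv_cancel₀ hm0.ne', one_smul, hb, ← map_add]
      rw [← LinearEquiv.symm_apply_eq]
      funext j
      rw [Pi.add_apply, Finset.sum_apply, Finset.sum_pi_single]
      simp
    rw [hsum]
    refine hPc.sum_mem (fun _ _ => by positivity) ?_ fun j _ => hqP j _ (hy j)
    rw [Finset.sum_const, Finset.card_univ, ← hm, nsmul_eq_mul]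
    field_simp
  refine ⟨W, ?_, ?_, ?_, ?_, ?_⟩
  · intro y hy i
    obtain ⟨j, v, hv, rfl⟩ := hWq y hy
    obtain ⟨a, ha⟩ := hV v hv (e.symm i).2
    obtain ⟨a', ha'⟩ := hV v₀ hv₀ (e.symm i).2
    by_cases hj : (e.symm i).1 = j
    · subst hj
      exact ⟨a' + m * (a - a'), by simp [q, hb, hT, blockEquiv_apply, ha, ha']⟩
    · exact ⟨a', by simp [q, hb, hT, blockEquiv_apply, ha', Pi.single_eq_of_ne hj]⟩
  · have hcont : Continuous T.symm := T.symm.toLinearMap.continuous_of_finiteDimensional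
    have hopen : IsOpen {y | ∀ j, T.symm y j ∈ interior K} := by
      simp only [Set.ofPred_forall]
      exact isOpen_iInter_of_finite fun j =>
        isOpen_interior.preimage ((continuous_apply j).comp hcont)
    refine ⟨T fun _ => c, interior_maximal (fun y hy => hbox y fun j =>
      interior_subset ((show ∀ j, T.symm y j ∈ interior K from hy) j)) hopen ?_⟩
    change ∀ j, T.symm (T fun _ => c) j ∈ interior K
    simpa using hc
  · intro z hz
    set C : Set (ι → ℝ) := (fun x => x - v₀) '' K with hC
    have hCc : Convex ℝ C := by
      have := hKc.translate (-v₀)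
      simpa [hC, sub_eq_neg_add] using this
    let Q : Set (κ → ℝ) := {y | ∃ l : α → ℝ, (∀ j, 0 ≤ l j) ∧ ∑ j, l j = m ∧
      ∀ j, T.symm y j - v₀ ∈ l j • C}
    have hQc : Convex ℝ Q := by
      rintro y ⟨l, hl0, hl1, hl⟩ y' ⟨l', hl0', hl1', hl'⟩ s t hs ht hst
      refine ⟨fun j => s * l j + t * l' j,
        fun j => add_nonneg (mul_nonneg hs (hl0 j)) (mul_nonneg ht (hl0' j)), ?_, fun j => ?_⟩
      · rw [Finset.sum_add_distrib, ← Finset.mul_sum, ← Finset.mul_sum, hl1, hl1', ← add_mul,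
          hst, one_mul]
      · rw [hCc.add_smul (mul_nonneg hs (hl0 j)) (mul_nonneg ht (hl0' j)), mul_smul, mul_smul]
        refine ⟨_, smul_mem_smul_set (hl j), _, smul_mem_smul_set (hl' j), ?_⟩
        have : v₀ = s • v₀ + t • v₀ := by rw [← add_smul, hst, one_smul]
        simp only [map_add, map_smul, Pi.add_apply, Pi.smul_apply]
        nth_rewrite 3 [this]
        module
    have hPQ : P ⊆ Q := by
      refine convexHull_min (fun y hy => ?_) hQc
      obtain ⟨j, v, hv, rfl⟩ := hWq y hy
      refine ⟨Pi.single j (m : ℝ), fun i => ?_, by simp, fun i => ?_⟩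
      · by_cases hij : i = j
        · subst hij; simp
        · simp [hij]
      · have hCv : v - v₀ ∈ C := ⟨v, hVK hv, rfl⟩
        by_cases hij : i = j
        · subst hij
          simpa [q, hb] using smul_mem_smul_set (a := (m : ℝ)) hCv
        · have : T.symm (q j v) i - v₀ = 0 := by simp [q, hb, hij]
          rw [this, Pi.single_eq_of_ne hij]
          exact ⟨_, hCv, zero_smul ℝ _⟩
    set zr : κ → ℝ := fun i => (z i : ℝ)
    obtain ⟨δ, hδ, hδP⟩ : ∃ δ : ℝ, 0 < δ ∧ zr + δ • (zr - T fun _ => c) ∈ P := by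
      have hcont : Continuous fun δ : ℝ => zr + δ • (zr - T fun _ => c) := by fun_prop
      have hmem : ∀ᶠ δ in nhds (0 : ℝ), zr + δ • (zr - T fun _ => c) ∈ P := by
        refine hcont.continuousAt.eventually_mem ?_
        simpa using mem_interior_iff_mem_nhds.1 hz
      obtain ⟨δ, h1, h2⟩ := ((hmem.filter_mono nhdsWithin_le_nhds).and
        (self_mem_nhdsWithin : Ioi (0 : ℝ) ∈ nhdsWithin 0 (Ioi 0))).exists
      exact ⟨δ, h2, h1⟩
    obtain ⟨l, hl0, hl1, hl⟩ := hPQ hδP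
    obtain ⟨j, -, hj⟩ : ∃ j ∈ Finset.univ, l j ≤ 1 := by
      refine Finset.exists_le_of_sum_le Finset.univ_nonempty ?_
      rw [hl1, Finset.sum_const, Finset.card_univ, nsmul_eq_mul, mul_one]
    obtain ⟨_, ⟨x, hx, rfl⟩, hxl⟩ := hl j
    have hyK : l j • x + (1 - l j) • v₀ ∈ K :=
      hKc hx (hVK hv₀) (hl0 j) (by linarith) (by ring)
    have hint := hKc.combo_interior_self_mem_interior hc hyK
      (a := δ / (1 + δ)) (b := 1 / (1 + δ)) (by positivity) (by positivity) (by field_simp; ring)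
    have hzj : (δ / (1 + δ)) • c + (1 / (1 + δ)) • (l j • x + (1 - l j) • v₀)
        = fun i => ((z (e (j, i)) : ℤ) : ℝ) := by
      have h1 : l j • (x - v₀) = T.symm zr j + δ • (T.symm zr j - c) - v₀ := by
        simpa using hxl
      have h2 : l j • x + (1 - l j) • v₀ = (1 + δ) • T.symm zr j - δ • c := by
        calc l j • x + (1 - l j) • v₀ = l j • (x - v₀) + v₀ := by module
          _ = _ := by rw [h1]; module
      have h3 : (T.symm zr j) = fun i => ((z (e (j, i)) : ℤ) : ℝ) := rfl
      rw [h2, ← h3, smul_sub, smul_smul, smul_smul, one_div_mul_cancel (by positivity), one_smul,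
        one_div_mul_eq_div]
      abel
    rw [hzj] at hint
    exact hhol (fun i => z (e (j, i))) hint
  · refine (Finset.card_insert_le _ _).trans (Nat.add_le_add_right ?_ 1)
    refine Finset.card_image_le.trans ?_
    rw [Finset.card_product, Finset.card_univ, Finset.card_erase_of_mem hv₀]
    exact Nat.mul_le_mul_left _ (Nat.sub_le_sub_right hcard 1)
  · have : Nonempty κ := e.nonempty_congr.1 inferInstance
    refine le_latticeWidth hPcomp fun f hf hf0 => ?_
    obtain ⟨j, hj⟩ : ∃ j, f ∘ₗ T.toLinearMap ∘ₗ LinearMap.single ℝ (fun _ => ι → ℝ) j ≠ 0 := by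
      by_contra! hall
      have h0 : f ∘ₗ T.toLinearMap = 0 := LinearMap.pi_ext' fun j => by
        simpa [LinearMap.comp_assoc] using hall j
      refine hf0 (LinearMap.ext fun y => ?_)
      simpa using LinearMap.congr_fun h0 (T.symm y)
    have hfj : IsIntegerFunctional
        (f ∘ₗ T.toLinearMap ∘ₗ LinearMap.single ℝ (fun _ => ι → ℝ) j) := by
      intro v
      obtain ⟨a, ha⟩ := hf fun i => (Pi.single j v : α → ι → ℤ) (e.symm i).1 (e.symm i).2
      refine ⟨a, ?_⟩
      rw [← ha, LinearMap.comp_apply, LinearMap.comp_apply]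
      congr 1
      funext i
      by_cases hij : (e.symm i).1 = j
      · subst hij
        simp [hT, blockEquiv_apply]
      · simp [hT, blockEquiv_apply, Pi.single_eq_of_ne hij]
    obtain ⟨x, hx, y, hy, hxy⟩ := exists_latticeWidth_le_sub hKcomp ⟨_, hVK hv₀⟩ hfj hj
    refine ⟨q j x, hqP j x hx, q j y, hqP j y hy, ?_⟩
    have hfq : f (q j x) - f (q j y) =
        m * (f (T (Pi.single j x)) - f (T (Pi.single j y))) := by
      simp only [q, map_add, map_smul, Pi.single_sub, map_sub, smul_eq_mul]
      ring
    rw [hfq]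
    exact mul_le_mul_of_nonneg_left (hw.trans hxy) hm0.le

/-- The coordinate inclusion `ℝ^n → ℝ^{n+1}`, appending a zero. -/
noncomputable def snocZero (n : ℕ) : (Fin n → ℝ) →ₗ[ℝ] (Fin (n + 1) → ℝ) where
  toFun x := Fin.snoc x 0
  map_add' x y := by
    funext i
    refine Fin.lastCases ?_ (fun i => ?_) i <;> simp
  map_smul' a x := by
    funext i
    refine Fin.lastCases ?_ (fun i => ?_) i <;> simp

@[simp]
theorem snocZero_castSucc {n : ℕ} (x : Fin n → ℝ) (i : Fin n) :
    snocZero n x i.castSucc = x i := by simp [snocZero]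

@[simp]
theorem snocZero_last {n : ℕ} (x : Fin n → ℝ) : snocZero n x (Fin.last n) = 0 := by
  simp [snocZero]

theorem eq_snocZero_add {n : ℕ} (y : Fin (n + 1) → ℝ) :
    y = snocZero n (fun i => y i.castSucc) + y (Fin.last n) • Pi.single (Fin.last n) 1 := by
  funext i
  refine Fin.lastCases ?_ (fun i => ?_) i
  · simp
  · simp

/-- A high pyramid over a polytope with apex above one of its vertices. -/
theorem HasHollowPolytope.pyramid {n k : ℕ} {w : ℝ} (h : HasHollowPolytope (Fin n) k w) :
    HasHollowPolytope (Fin (n + 1)) (k + 1) w := by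
  classical
  obtain ⟨V, hV, hint, hhol, hcard, hw⟩ := h
  have hVne : V.Nonempty := by
    rw [← Finset.coe_nonempty, ← convexHull_nonempty_iff (𝕜 := ℝ)]
    exact hint.mono interior_subset
  obtain ⟨v₀, hv₀⟩ := hVne
  set K := convexHull ℝ (V : Set (Fin n → ℝ))
  have hKc : Convex ℝ K := convex_convexHull ℝ _
  have hVK : (V : Set (Fin n → ℝ)) ⊆ K := subset_convexHull ℝ _
  have hKcomp : IsCompact K := V.finite_toSet.isCompact_convexHull ℝ
  obtain ⟨N, hN⟩ := exists_nat_gt (max w 0)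
  have hN0 : (0 : ℝ) < N := (le_max_right _ _).trans_lt hN
  have hNw : w ≤ N := ((le_max_left _ _).trans_lt hN).le
  let E : Fin (n + 1) → ℝ := Pi.single (Fin.last n) 1
  have hElast : E (Fin.last n) = 1 := by simp [E]
  have hEcast : ∀ i : Fin n, E i.castSucc = 0 := fun i => by simp [E]
  let W : Finset (Fin (n + 1) → ℝ) :=
    insert (snocZero n v₀ + (N : ℝ) • E) (V.image (snocZero n))
  have hapex : snocZero n v₀ + (N : ℝ) • E ∈ W := Finset.mem_insert_self _ _
  have hbase : ∀ v ∈ V, snocZero n v ∈ W := fun v hv =>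
    Finset.mem_insert_of_mem (Finset.mem_image_of_mem _ hv)
  set P := convexHull ℝ (W : Set (Fin (n + 1) → ℝ))
  have hPc : Convex ℝ P := convex_convexHull ℝ _
  have hWP : (W : Set (Fin (n + 1) → ℝ)) ⊆ P := subset_convexHull ℝ _
  have hPcomp : IsCompact P := W.finite_toSet.isCompact_convexHull ℝ
  have hKP : ∀ x ∈ K, snocZero n x ∈ P := by
    have : K ⊆ snocZero n ⁻¹' P :=
      convexHull_min (fun v hv => hWP (hbase v hv)) (hPc.linear_preimage (snocZero n))
    exact this
  refine ⟨W, ?_, ?_, ?_, ?_, ?_⟩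
  · intro y hy i
    rcases Finset.mem_insert.1 hy with rfl | hy
    · refine Fin.lastCases ⟨N, by simp [hElast]⟩ (fun i => ?_) i
      simpa [hEcast] using hV v₀ hv₀ i
    · obtain ⟨v, hv, rfl⟩ := Finset.mem_image.1 hy
      refine Fin.lastCases ⟨0, by simp⟩ (fun i => ?_) i
      simpa using hV v hv i
  · rw [interior_convexHull_nonempty_iff_affineSpan_eq_top] at hint ⊢
    rw [eq_top_iff]
    intro y _
    have hb : ∀ x, snocZero n x ∈ affineSpan ℝ (W : Set (Fin (n + 1) → ℝ)) := by
      intro x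
      have hx : snocZero n x ∈ (affineSpan ℝ (V : Set (Fin n → ℝ))).map
          (snocZero n).toAffineMap := by
        rw [hint]
        exact ⟨x, trivial, rfl⟩
      rw [AffineSubspace.map_span] at hx
      refine affineSpan_mono ℝ ?_ hx
      rintro _ ⟨v, hv, rfl⟩
      exact hbase v hv
    have := AffineSubspace.smul_vsub_vadd_mem _ (y (Fin.last n) / N)
      (subset_affineSpan ℝ _ hapex) (hb v₀) (hb fun i => y i.castSucc)
    convert this using 1
    rw [vsub_eq_sub, vadd_eq_add, add_sub_cancel_left, smul_smul, div_mul_cancel₀ _ hN0.ne']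
    exact (eq_snocZero_add y).trans (add_comm _ _)
  · intro z hz
    let π : (Fin (n + 1) → ℝ) →L[ℝ] (Fin n → ℝ) :=
      ContinuousLinearMap.pi fun i => ContinuousLinearMap.proj i.castSucc
    have hπ : ∀ y i, π y i = y i.castSucc := fun _ _ => rfl
    have hsurj : Function.Surjective π := fun x => ⟨snocZero n x, by
      funext i
      simp [hπ]⟩
    have hsub : P ⊆ π ⁻¹' K := by
      refine convexHull_min (fun y hy => ?_) (hKc.linear_preimage π.toLinearMap)
      rcases Finset.mem_insert.1 hy with rfl | hy
      · have : π (snocZero n v₀ + (N : ℝ) • E) = v₀ := by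
          funext i
          simp [hπ, hEcast]
        rw [mem_preimage, this]
        exact hVK hv₀
      · obtain ⟨v, hv, rfl⟩ := Finset.mem_image.1 hy
        have : π (snocZero n v) = v := by
          funext i
          simp [hπ]
        rw [mem_preimage, this]
        exact hVK hv
    have hopen : IsOpenMap π := π.isOpenMap hsurj
    have himg : π '' interior P ⊆ interior K :=
      interior_maximal (image_subset_iff.2 (interior_subset.trans hsub))
        (hopen _ isOpen_interior)
    exact hhol (fun i => z i.castSucc) (himg ⟨_, hz, rfl⟩)
  · exact (Finset.card_insert_le _ _).trans
      (Nat.add_le_add_right (Finset.card_image_le.trans hcard) 1)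
  · refine le_latticeWidth hPcomp fun f hf hf0 => ?_
    by_cases h0 : f ∘ₗ snocZero n = 0
    · have hsn : ∀ x, f (snocZero n x) = 0 := fun x => LinearMap.congr_fun h0 x
      have hfE : f E ≠ 0 := by
        intro hfE
        refine hf0 (LinearMap.ext fun y => ?_)
        rw [eq_snocZero_add y, map_add, map_smul, hsn]
        simp [show f (Pi.single (Fin.last n) 1) = 0 from hfE]
      obtain ⟨a, ha⟩ := hf (Pi.single (Fin.last n) 1)
      have hEa : f E = a := by
        rw [← ha]
        congr 1
        funext i
        by_cases hi : i = Fin.last n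
        · subst hi; simp [E]
        · simp [E, Pi.single_eq_of_ne hi]
      have habs : (1 : ℝ) ≤ |f E| := by
        rw [hEa] at hfE ⊢
        exact_mod_cast Int.one_le_abs (by exact_mod_cast hfE)
      have hA := hWP hapex
      have hB := hWP (hbase v₀ hv₀)
      rcases le_total 0 (f E) with hs | hs
      · refine ⟨_, hA, _, hB, ?_⟩
        rw [abs_of_nonneg hs] at habs
        simp only [map_add, map_smul, hsn, smul_eq_mul]
        nlinarith
      · refine ⟨_, hB, _, hA, ?_⟩
        rw [abs_of_nonpos hs] at habs
        simp only [map_add, map_smul, hsn, smul_eq_mul]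
        nlinarith
    · have hfs : IsIntegerFunctional (f ∘ₗ snocZero n) := by
        intro v
        obtain ⟨a, ha⟩ := hf (Fin.snoc v 0 : Fin (n + 1) → ℤ)
        refine ⟨a, ?_⟩
        rw [← ha, LinearMap.comp_apply]
        congr 1
        funext i
        refine Fin.lastCases ?_ (fun i => ?_) i <;> simp
      obtain ⟨x, hx, y, hy, hxy⟩ := exists_latticeWidth_le_sub hKcomp ⟨_, hVK hv₀⟩ hfs h0
      exact ⟨_, hKP x hx, _, hKP y hy, hw.trans hxy⟩

theorem wp_eq_iSup (n : ℕ) :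
    wp n = ⨆ (w : ℝ) (_ : ∃ k, HasHollowPolytope (Fin n) k w), ENNReal.ofReal w := by
  apply le_antisymm
  · exact iSup_le fun V => iSup_le fun hV => iSup_le fun hint => iSup_le fun hhol =>
      le_iSup₂_of_le _ ⟨V.card, V, hV, hint, hhol, le_rfl, le_rfl⟩ le_rfl
  · refine iSup₂_le fun w hw => ?_
    obtain ⟨k, V, hV, hint, hhol, -, hwV⟩ := hw
    exact le_iSup_of_le V <| le_iSup_of_le hV <| le_iSup_of_le hint <| le_iSup_of_le hhol <|
      ENNReal.ofReal_le_ofReal hwV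

theorem ws_eq_iSup (n : ℕ) :
    ws n = ⨆ (w : ℝ) (_ : HasHollowPolytope (Fin n) (n + 1) w), ENNReal.ofReal w := by
  classical
  apply le_antisymm
  · refine iSup_le fun v => iSup_le fun hv => iSup_le fun hlat => iSup_le fun hhol => ?_
    refine le_iSup₂_of_le _ ⟨Finset.univ.image v, ?_, ?_, ?_, ?_, le_rfl⟩ ?_
    · simpa using hlat
    · rw [interior_convexHull_nonempty_iff_affineSpan_eq_top]
      simpa using hv.affineSpan_eq_top_iff_card_eq_finrank_add_one.2 (by simp)
    · simpa using hhol
    · exact Finset.card_image_le.trans (by simp)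
    · simp
  · refine iSup₂_le fun w hw => ?_
    obtain ⟨V, hV, hint, hhol, hcard, hwV⟩ := hw
    have hVne : V.Nonempty := by
      rw [← Finset.coe_nonempty, ← convexHull_nonempty_iff (𝕜 := ℝ)]
      exact hint.mono interior_subset
    have : Nonempty V := hVne.to_subtype
    obtain ⟨g⟩ : Nonempty (V ↪ Fin (n + 1)) :=
      Function.Embedding.nonempty_of_card_le (by simpa using hcard)
    let v : Fin (n + 1) → (Fin n → ℝ) := fun j => (Function.invFun g j : V)
    have hrange : Set.range v = (V : Set (Fin n → ℝ)) := by
      have : Set.range v = Set.range ((↑) : V → Fin n → ℝ) :=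
        (Function.invFun_surjective g.injective).range_comp _
      simpa using this
    have hind : AffineIndependent ℝ v := by
      rw [affineIndependent_iff_le_finrank_vectorSpan ℝ v (n := n) (by simp), hrange,
        ← direction_affineSpan, interior_convexHull_nonempty_iff_affineSpan_eq_top.1 hint,
        AffineSubspace.direction_top, finrank_top]
      simp
    refine le_iSup_of_le v <| le_iSup_of_le hind <|
      le_iSup_of_le (fun j => hV _ (Function.invFun g j).2) <| le_iSup_of_le ?_ ?_
    · rwa [hrange]
    · rw [hrange]
      exact ENNReal.ofReal_le_ofReal hwV

theorem ws_le_ws_succ (n : ℕ) : ws n ≤ ws (n + 1) := by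
  rw [ws_eq_iSup, ws_eq_iSup]
  exact iSup₂_le fun w hw => le_iSup₂_of_le w hw.pyramid le_rfl

theorem wp_le_wp_succ (n : ℕ) : wp n ≤ wp (n + 1) := by
  rw [wp_eq_iSup, wp_eq_iSup]
  exact iSup₂_le fun w ⟨k, hw⟩ => le_iSup₂_of_le w ⟨k + 1, hw.pyramid⟩ le_rfl

theorem HasHollowPolytope.mul {m d k : ℕ} (hm : 0 < m) (hd : 0 < d) {w : ℝ}
    (h : HasHollowPolytope (Fin d) k w) :
    HasHollowPolytope (Fin (m * d)) (m * (k - 1) + 1) (m * w) := by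
  have := Fin.pos_iff_nonempty.1 hm
  have := Fin.pos_iff_nonempty.1 hd
  simpa using h.directSum (finProdFinEquiv (m := m) (n := d))

theorem natCast_mul_ws_le {m d : ℕ} (hm : 0 < m) (hd : 0 < d) : m * ws d ≤ ws (m * d) := by
  simp only [ws_eq_iSup, ENNReal.mul_iSup]
  refine iSup₂_le fun w hw => le_iSup₂_of_le (m * w) (hw.mul hm hd) ?_
  rw [ENNReal.ofReal_mul (Nat.cast_nonneg m), ENNReal.ofReal_natCast]

theorem natCast_mul_wp_le {m d : ℕ} (hm : 0 < m) (hd : 0 < d) : m * wp d ≤ wp (m * d) := by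
  simp only [wp_eq_iSup, ENNReal.mul_iSup]
  refine iSup₂_le fun w ⟨k, hw⟩ => le_iSup₂_of_le (m * w) ⟨_, hw.mul hm hd⟩ ?_
  rw [ENNReal.ofReal_mul (Nat.cast_nonneg m), ENNReal.ofReal_natCast]

theorem tendsto_natCast_div_add_one_ennreal :
    Tendsto (fun m : ℕ => (m : ℝ≥0∞) / ((m + 1 : ℕ) : ℝ≥0∞)) atTop (nhds 1) := by
  have h := ENNReal.tendsto_ofReal (tendsto_natCast_div_add_atTop (1 : ℝ))
  rw [ENNReal.ofReal_one] at h
  refine h.congr fun m => ?_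
  rw [ENNReal.ofReal_div_of_pos (by positivity), ENNReal.ofReal_natCast]
  congr 1
  exact_mod_cast ENNReal.ofReal_natCast (m + 1)

/-- A variant of Fekete's lemma for monotone sequences. -/
theorem tendsto_div_iSup_of_monotone {u : ℕ → ℝ≥0∞} (hmono : Monotone u)
    (hmul : ∀ {m d : ℕ}, 0 < m → 0 < d → m * u d ≤ u (m * d)) :
    Tendsto (fun d : ℕ => u d / (d : ℝ≥0∞)) atTop
      (nhds (⨆ (d : ℕ) (_ : 0 < d), u d / (d : ℝ≥0∞))) := by
  refine tendsto_order.2 ⟨fun a ha => ?_, fun a ha => ?_⟩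
  · obtain ⟨d, ha⟩ := lt_iSup_iff.1 ha
    obtain ⟨hd, ha⟩ := lt_iSup_iff.1 ha
    have hlim : Tendsto (fun n : ℕ =>
        ((n / d : ℕ) : ℝ≥0∞) / ((n / d + 1 : ℕ) : ℝ≥0∞) * (u d / d)) atTop (nhds (u d / d)) := by
      have := ENNReal.Tendsto.mul_const (b := u d / d)
        (tendsto_natCast_div_add_one_ennreal.comp (Nat.tendsto_div_const_atTop hd.ne'))
        (Or.inl one_ne_zero)
      simpa using this
    filter_upwards [hlim.eventually_const_lt ha, eventually_ge_atTop d] with n hn hdn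
    refine hn.trans_le ?_
    have hm : 0 < n / d := Nat.div_pos hdn hd
    have hle : n ≤ (n / d + 1) * d := (Nat.lt_mul_of_div_lt (Nat.lt_succ_self _) hd).le
    calc ((n / d : ℕ) : ℝ≥0∞) / ((n / d + 1 : ℕ) : ℝ≥0∞) * (u d / d)
        = ((n / d : ℕ) * u d) / (((n / d + 1) * d : ℕ) : ℝ≥0∞) := by
          rw [Nat.cast_mul, ENNReal.mul_div_mul_comm (Or.inl (by simp)) (Or.inl (by simp))]
      _ ≤ u n / n := ENNReal.div_le_div
          ((hmul hm hd).trans (hmono (Nat.div_mul_le_self n d))) (by exact_mod_cast hle)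
  · filter_upwards [eventually_gt_atTop 0] with n hn
    exact (le_iSup₂ (f := fun (d : ℕ) (_ : 0 < d) => u d / (d : ℝ≥0∞)) n hn).trans_lt ha

theorem tendsto_ws_div_and_wp_div :
    (Tendsto (fun d : ℕ => ws d / (d : ℝ≥0∞)) atTop
      (nhds (⨆ (d : ℕ) (_ : 0 < d), ws d / (d : ℝ≥0∞)))) ∧
    (Tendsto (fun d : ℕ => wp d / (d : ℝ≥0∞)) atTop
      (nhds (⨆ (d : ℕ) (_ : 0 < d), wp d / (d : ℝ≥0∞)))) :=
  ⟨tendsto_div_iSup_of_monotone (monotone_nat_of_le_succ ws_le_ws_succ) natCast_mul_ws_le,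
    tendsto_div_iSup_of_monotone (monotone_nat_of_le_succ wp_le_wp_succ) natCast_mul_wp_le⟩
end

section
/- One has sup_{d≥1} w_c(d)/d = sup_{d≥1} w_p(d)/d (equality of suprema in [0,∞]). -/
open Set ENNReal

/-- `w_c(n)`: the supremum in `[0,∞]` of the lattice widths of all hollow convex
bodies in `ℝ^n`. -/
noncomputable def wc (n : ℕ) : ℝ≥0∞ :=
  ⨆ (K : Set (Fin n → ℝ)) (_ : IsCompact K) (_ : Convex ℝ K)
    (_ : (interior K).Nonempty)
    (_ : ∀ z : Fin n → ℤ, (fun i => (z i : ℝ)) ∉ interior K),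
    ENNReal.ofReal (latticeWidth K)

section

open scoped Topology Pointwise

lemma mul_width_le_width {E F : Type*} [AddCommGroup E] [Module ℝ E] [TopologicalSpace E]
    [AddCommGroup F] [Module ℝ F] [TopologicalSpace F] {A : Set E} {B : Set F}
    (hA : IsCompact A) (hne : A.Nonempty) (hB : IsCompact B)
    {f : E →ₗ[ℝ] ℝ} {g : F →ₗ[ℝ] ℝ} (hf : Continuous f) (hg : Continuous g)
    {φ : E → F} (hφ : MapsTo φ A B) {a b : ℝ} (h : ∀ x ∈ A, g (φ x) = a * f x + b) :
    a * (sSup (f '' A) - sInf (f '' A)) ≤ sSup (g '' B) - sInf (g '' B) := by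
  obtain ⟨x, hx, hxs⟩ := hA.exists_sSup_image_eq hne hf.continuousOn
  obtain ⟨y, hy, hys⟩ := hA.exists_sInf_image_eq hne hf.continuousOn
  have hc := hB.image hg
  have h1 := le_csSup hc.bddAbove (mem_image_of_mem g (hφ hx))
  have h2 := csInf_le hc.bddBelow (mem_image_of_mem g (hφ hy))
  rw [h x hx] at h1
  rw [h y hy] at h2
  rw [hxs, hys]
  linarith

lemma width_nonneg {E : Type*} [AddCommGroup E] [Module ℝ E] [TopologicalSpace E]
    {A : Set E} (hA : IsCompact A) {f : E →ₗ[ℝ] ℝ} (hf : Continuous f) :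
    0 ≤ sSup (f '' A) - sInf (f '' A) :=
  sub_nonneg.2 (Real.sInf_le_sSup _ (hA.image hf).bddBelow (hA.image hf).bddAbove)

lemma latticeWidth_le {ι : Type*} [Finite ι] {K : Set (ι → ℝ)} (hK : IsCompact K)
    {f : (ι → ℝ) →ₗ[ℝ] ℝ} (hf : ∀ v : ι → ℤ, ∃ k : ℤ, f (fun i => (v i : ℝ)) = (k : ℝ))
    (hf0 : f ≠ 0) : latticeWidth K ≤ sSup (f '' K) - sInf (f '' K) := by
  refine csInf_le ⟨0, ?_⟩ ⟨f, hf, hf0, rfl⟩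
  rintro _ ⟨g, -, -, rfl⟩
  exact width_nonneg hK g.continuous_of_finiteDimensional

lemma le_latticeWidth_s16 {ι : Type*} [Nonempty ι] {K : Set (ι → ℝ)} {w : ℝ}
    (h : ∀ f : (ι → ℝ) →ₗ[ℝ] ℝ, (∀ v : ι → ℤ, ∃ k : ℤ, f (fun i => (v i : ℝ)) = (k : ℝ)) →
      f ≠ 0 → w ≤ sSup (f '' K) - sInf (f '' K)) : w ≤ latticeWidth K := by
  obtain ⟨i⟩ := ‹Nonempty ι›
  refine le_csInf ⟨_, LinearMap.proj i, fun v => ⟨v i, rfl⟩, fun h0 => ?_, rfl⟩ ?_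
  · simpa using LinearMap.congr_fun h0 (fun _ => 1)
  · rintro _ ⟨f, hf, hf0, rfl⟩
    exact h f hf hf0

lemma mul_latticeWidth_le {ι : Type*} [Finite ι] [Nonempty ι] {A B : Set (ι → ℝ)}
    (hA : IsCompact A) (hne : A.Nonempty) (hB : IsCompact B) {a : ℝ} (ha : 0 ≤ a) {b : ι → ℝ}
    (h : ∀ x ∈ A, a • x + b ∈ B) : a * latticeWidth A ≤ latticeWidth B := by
  refine le_latticeWidth_s16 fun f hf hf0 => ?_
  refine (mul_le_mul_of_nonneg_left (latticeWidth_le hA hf hf0) ha).trans ?_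
  exact mul_width_le_width hA hne hB f.continuous_of_finiteDimensional
    f.continuous_of_finiteDimensional (φ := fun x => a • x + b) h (b := f b) (by simp)

/-- A hollow convex body can be enlarged by a homothety, without decreasing its lattice width,
until its boundary contains a lattice point, which can be translated to the origin. -/
lemma exists_hollow_zero_mem {ι : Type*} [Fintype ι] [Nonempty ι] {K : Set (ι → ℝ)}
    (hK : IsCompact K) (hconv : Convex ℝ K) (hint : (interior K).Nonempty)
    (hhol : ∀ z : ι → ℤ, (fun i => (z i : ℝ)) ∉ interior K) :
    ∃ L : Set (ι → ℝ), IsCompact L ∧ Convex ℝ L ∧ (interior L).Nonempty ∧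
      (∀ z : ι → ℤ, (fun i => (z i : ℝ)) ∉ interior L) ∧ 0 ∈ L ∧
      latticeWidth K ≤ latticeWidth L := by
  obtain ⟨c, hc⟩ := hint
  set B : Set (ι → ℝ) := (Homeomorph.addRight c) ⁻¹' K
  have hmemB : ∀ x, x ∈ B ↔ x + c ∈ K := fun x => Iff.rfl
  have hBint : interior B = (Homeomorph.addRight c) ⁻¹' interior K :=
    ((Homeomorph.addRight c).preimage_interior K).symm
  have hmemBi : ∀ x, x ∈ interior B ↔ x + c ∈ interior K := fun x => by rw [hBint]; rfl
  have hBc : IsCompact B := (Homeomorph.addRight c).isCompact_preimage.2 hK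
  have hBconv : Convex ℝ B := by
    have := hconv.translate_preimage_left c
    exact this
  have h0 : (0 : ι → ℝ) ∈ interior B := by rw [hmemBi]; simpa using hc
  have hBn : B ∈ 𝓝 (0 : ι → ℝ) := mem_interior_iff_mem_nhds.1 h0
  have hcont : Continuous (gauge B) := continuous_gauge hBconv hBn
  have hlt : ∀ x, gauge B x < 1 ↔ x ∈ interior B := fun x =>
    gauge_lt_one_iff_mem_interior hBconv hBn
  have hle : ∀ x, gauge B x ≤ 1 ↔ x ∈ B := fun x => by
    rw [gauge_le_one_iff_mem_closure hBconv hBn, hBc.isClosed.closure_eq]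
  let g : (ι → ℤ) → ℝ := fun z => gauge B ((fun i => (z i : ℝ)) - c)
  have hg1 : ∀ z, 1 ≤ g z := fun z => by
    by_contra! h
    have := (hmemBi _).1 ((hlt _).1 h)
    rw [sub_add_cancel] at this
    exact hhol z this
  obtain ⟨R, hR0, hR⟩ := hBc.isBounded.subset_closedBall_lt 0 (0 : ι → ℝ)
  obtain ⟨z₀, hz₀⟩ : ∃ z₀, ∀ z, g z₀ ≤ g z := by
    have hfin : {z : ι → ℤ | g z ≤ g 0}.Finite := by
      classical
      refine (Set.finite_Icc (fun _ : ι => -⌈g 0 * R + ‖c‖⌉) (fun _ => ⌈g 0 * R + ‖c‖⌉)).subset ?_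
      intro z hz
      have h1 := (le_gauge_of_subset_closedBall (absorbent_nhds_zero hBn) hR0.le hR).trans hz
      rw [div_le_iff₀ hR0] at h1
      have h2 : ∀ i, |(z i : ℝ)| ≤ ⌈g 0 * R + ‖c‖⌉ := fun i =>
        calc |(z i : ℝ)| = ‖((fun i => (z i : ℝ)) - c + c) i‖ := by simp
          _ ≤ ‖(fun i => (z i : ℝ)) - c + c‖ := norm_le_pi_norm _ i
          _ ≤ ‖(fun i => (z i : ℝ)) - c‖ + ‖c‖ := norm_add_le _ _
          _ ≤ g 0 * R + ‖c‖ := by gcongr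
          _ ≤ _ := Int.le_ceil _
      exact ⟨fun i => by exact_mod_cast (abs_le.1 (h2 i)).1,
        fun i => by exact_mod_cast (abs_le.1 (h2 i)).2⟩
    obtain ⟨z₀, hz₀, hmin⟩ := Set.exists_min_image _ g hfin ⟨0, le_refl (g 0)⟩
    refine ⟨z₀, fun z => ?_⟩
    by_cases hz : g z ≤ g 0
    · exact hmin z hz
    · exact hz₀.trans (not_le.1 hz).le
  set t := g z₀ with ht
  have ht1 : 1 ≤ t := hg1 z₀
  have ht0 : 0 < t := by linarith
  have hgs : ∀ x, gauge B (t⁻¹ • x) = t⁻¹ * gauge B x := fun x => by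
    rw [gauge_smul_of_nonneg (by positivity), smul_eq_mul]
  let ψ : (ι → ℝ) ≃ₜ (ι → ℝ) := (Homeomorph.addRight ((fun i => (z₀ i : ℝ)) - c)).trans
    (Homeomorph.smulOfNeZero t⁻¹ (by positivity))
  have hψ : ∀ x, ψ x = t⁻¹ • (x + ((fun i => (z₀ i : ℝ)) - c)) := fun x => rfl
  have hLc : IsCompact (ψ ⁻¹' B) := ψ.isCompact_preimage.2 hBc
  refine ⟨ψ ⁻¹' B, hLc, ?_, ?_, ?_, ?_, ?_⟩
  · intro x hx y hy a b ha hb hab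
    have := hBconv hx hy ha hb hab
    simp only [mem_preimage, hψ] at this ⊢
    convert this using 1
    rw [← eq_sub_iff_add_eq'] at hab
    subst hab
    module
  · rw [← ψ.preimage_interior]
    exact ⟨ψ.symm 0, by simpa using h0⟩
  · intro z hz
    rw [← ψ.preimage_interior, mem_preimage, ← hlt, hψ, hgs, inv_mul_lt_iff₀ ht0, mul_one] at hz
    refine (hz₀ (z + z₀)).not_gt ?_
    convert hz using 2
    ext i
    simp
    ring
  · rw [mem_preimage, ← hle, hψ, hgs, zero_add, inv_mul_le_iff₀ ht0, mul_one]
  · refine (le_mul_of_one_le_left ?_ ht1).trans (mul_latticeWidth_le hK ⟨c, interior_subset hc⟩ hLc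
      ht0.le (b := -t • c - ((fun i => (z₀ i : ℝ)) - c)) fun x hx => ?_)
    · exact le_latticeWidth_s16 fun f _ _ => width_nonneg hK f.continuous_of_finiteDimensional
    · rw [mem_preimage, hψ, hmemB]
      convert hx using 1
      rw [add_assoc, sub_add_cancel, neg_smul, ← sub_eq_add_neg, ← smul_sub, inv_smul_smul₀ ht0.ne',
        sub_add_cancel]

/-- Every point of an open set lies in the interior of a box with rational vertices contained
in the set. -/
lemma exists_rational_mem_interior_convexHull {ι : Type*} [Fintype ι] {U : Set (ι → ℝ)}
    (hU : IsOpen U) {x : ι → ℝ} (hx : x ∈ U) :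
    ∃ V : Finset (ι → ℝ), (∀ v ∈ V, ∀ i, ∃ q : ℚ, v i = q) ∧ (V : Set (ι → ℝ)) ⊆ U ∧
      x ∈ interior (convexHull ℝ (V : Set (ι → ℝ))) := by
  classical
  obtain ⟨ε, hε, hεU⟩ := Metric.isOpen_iff.1 hU x hx
  have ha : ∀ i, ∃ q : ℚ, x i - ε < q ∧ (q : ℝ) < x i := fun i => exists_rat_btwn (by linarith)
  have hb : ∀ i, ∃ q : ℚ, x i < q ∧ (q : ℝ) < x i + ε := fun i => exists_rat_btwn (by linarith)
  choose a ha1 ha2 using ha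
  choose b hb1 hb2 using hb
  have hfin : (Set.pi univ fun i => ({(a i : ℝ), (b i : ℝ)} : Set ℝ)).Finite :=
    Set.Finite.pi fun i => Set.toFinite _
  refine ⟨hfin.toFinset, ?_, ?_, ?_⟩
  · intro v hv i
    rw [Set.Finite.mem_toFinset] at hv
    rcases hv i trivial with h | h
    · exact ⟨a i, h⟩
    · exact ⟨b i, h⟩
  · intro v hv
    rw [Set.Finite.coe_toFinset] at hv
    refine hεU ?_
    rw [Metric.mem_ball, dist_pi_lt_iff hε]
    intro i
    rw [Real.dist_eq, abs_lt]
    have h1 := ha1 i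
    have h2 := ha2 i
    have h3 := hb1 i
    have h4 := hb2 i
    rcases hv i trivial with h | h <;> rw [h] <;> constructor <;> linarith
  · rw [Set.Finite.coe_toFinset, convexHull_pi, interior_pi_set finite_univ]
    intro i _
    have h1 := ha2 i
    have h2 := hb1 i
    dsimp only
    rw [convexHull_pair, segment_eq_Icc (h1.trans h2).le, interior_Icc]
    exact ⟨h1, h2⟩

lemma exists_rational_subset_interior_convexHull {ι : Type*} [Fintype ι] {U C : Set (ι → ℝ)}
    (hU : IsOpen U) (hC : IsCompact C) (hCU : C ⊆ U) :
    ∃ V : Finset (ι → ℝ), (∀ v ∈ V, ∀ i, ∃ q : ℚ, v i = q) ∧ (V : Set (ι → ℝ)) ⊆ U ∧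
      C ⊆ interior (convexHull ℝ (V : Set (ι → ℝ))) := by
  classical
  refine hC.induction_on (p := fun C => ∃ V : Finset (ι → ℝ), (∀ v ∈ V, ∀ i, ∃ q : ℚ, v i = q) ∧
    (V : Set (ι → ℝ)) ⊆ U ∧ C ⊆ interior (convexHull ℝ (V : Set (ι → ℝ)))) ?_ ?_ ?_ ?_
  · exact ⟨∅, by simp⟩
  · rintro s t hst ⟨V, h1, h2, h3⟩
    exact ⟨V, h1, h2, hst.trans h3⟩
  · rintro s t ⟨V, h1, h2, h3⟩ ⟨W, h1', h2', h3'⟩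
    refine ⟨V ∪ W, fun v hv => ?_, ?_, ?_⟩
    · rcases Finset.mem_union.1 hv with h | h
      · exact h1 v h
      · exact h1' v h
    · rw [Finset.coe_union]
      exact union_subset h2 h2'
    · rw [Finset.coe_union]
      exact union_subset (h3.trans (interior_mono (convexHull_mono subset_union_left)))
        (h3'.trans (interior_mono (convexHull_mono subset_union_right)))
  · intro x hx
    obtain ⟨V, h1, h2, h3⟩ := exists_rational_mem_interior_convexHull hU (hCU hx)
    exact ⟨_, mem_nhdsWithin_of_mem_nhds (isOpen_interior.mem_nhds h3), V, h1, h2, subset_rfl⟩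

lemma exists_common_denominator {ι : Type*} [Fintype ι] (V : Finset (ι → ℝ))
    (hV : ∀ v ∈ V, ∀ i, ∃ q : ℚ, v i = q) :
    ∃ N : ℕ, 0 < N ∧ ∀ v ∈ V, ∀ i, ∃ k : ℤ, (N : ℝ) * v i = k := by
  classical
  choose! q hq using hV
  refine ⟨∏ v ∈ V, ∏ i, (q v i).den,
    Finset.prod_pos fun v _ => Finset.prod_pos fun i _ => (q v i).den_pos, fun v hv i => ?_⟩
  obtain ⟨m, hm⟩ := (Finset.dvd_prod_of_mem (fun i => (q v i).den) (Finset.mem_univ i)).trans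
    (Finset.dvd_prod_of_mem (fun v => ∏ i, (q v i).den) hv)
  refine ⟨m * (q v i).num, ?_⟩
  rw [hm, hq v hv i]
  have h : ((q v i).den : ℝ) * (q v i : ℝ) = (q v i).num := by
    exact_mod_cast Rat.den_mul_eq_num (q v i)
  push_cast
  rw [← h]
  ring

/-- The inclusion of the `i`-th of `N` blocks of coordinates. -/
def blockInl {d N : ℕ} (i : Fin N) : (Fin d → ℝ) →ₗ[ℝ] (Fin (N * d) → ℝ) where
  toFun v k := if (finProdFinEquiv.symm k).1 = i then v (finProdFinEquiv.symm k).2 else 0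
  map_add' _ _ := by ext k; simp only [Pi.add_apply]; split_ifs <;> simp
  map_smul' _ _ := by ext k; simp

/-- The projection to the `i`-th of `N` blocks of coordinates. -/
def blockProj {d N : ℕ} (i : Fin N) : (Fin (N * d) → ℝ) →ₗ[ℝ] (Fin d → ℝ) where
  toFun x j := x (finProdFinEquiv (i, j))
  map_add' _ _ := rfl
  map_smul' _ _ := rfl

lemma blockProj_blockInl {d N : ℕ} (i j : Fin N) (v : Fin d → ℝ) :
    blockProj i (blockInl j v) = if i = j then v else 0 := by
  ext k
  simp only [blockProj, blockInl, LinearMap.coe_mk, AddHom.coe_mk, Equiv.symm_apply_apply]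
  split_ifs <;> rfl

lemma sum_blockInl_blockProj {d N : ℕ} (x : Fin (N * d) → ℝ) :
    ∑ i, blockInl i (blockProj i x) = x := by
  ext k
  obtain ⟨⟨i, j⟩, rfl⟩ := finProdFinEquiv.surjective k
  simp only [blockProj, blockInl, LinearMap.coe_mk, AddHom.coe_mk, Finset.sum_apply,
    Equiv.symm_apply_apply, Finset.sum_ite_eq, Finset.mem_univ, if_true]

/-- The direct sum of `N` copies of the `N`-th dilate of a polytope. -/
noncomputable def dilatedSum {d : ℕ} (N : ℕ) (V : Finset (Fin d → ℝ)) :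
    Finset (Fin (N * d) → ℝ) :=
  open Classical in Finset.univ.biUnion fun i : Fin N => V.image fun v => blockInl i ((N : ℝ) • v)

lemma mem_dilatedSum {d N : ℕ} {V : Finset (Fin d → ℝ)} {x : Fin (N * d) → ℝ} :
    x ∈ dilatedSum N V ↔ ∃ i : Fin N, ∃ v ∈ V, blockInl i ((N : ℝ) • v) = x := by
  simp [dilatedSum]

lemma blockInl_mem_dilatedSum {d N : ℕ} {V : Finset (Fin d → ℝ)} {v : Fin d → ℝ}
    (hv : v ∈ convexHull ℝ (V : Set (Fin d → ℝ))) (i : Fin N) :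
    blockInl i ((N : ℝ) • v) ∈ convexHull ℝ (dilatedSum N V : Set (Fin (N * d) → ℝ)) := by
  have h : convexHull ℝ (V : Set (Fin d → ℝ)) ⊆ ((N : ℝ) • blockInl i : _ →ₗ[ℝ] _) ⁻¹'
      convexHull ℝ (dilatedSum N V : Set (Fin (N * d) → ℝ)) := by
    refine convexHull_min (fun v hv => subset_convexHull ℝ _ ?_)
      ((convex_convexHull ℝ _).linear_preimage _)
    exact mem_dilatedSum.2 ⟨i, v, hv, by simp⟩
  simpa using h hv

lemma exists_blockProj_mem {d N : ℕ} (hN : 0 < N) {V : Finset (Fin d → ℝ)} (h0 : 0 ∈ V)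
    {x : Fin (N * d) → ℝ} (hx : x ∈ convexHull ℝ (dilatedSum N V : Set (Fin (N * d) → ℝ))) :
    ∃ i : Fin N, blockProj i x ∈ convexHull ℝ (V : Set (Fin d → ℝ)) := by
  set P := convexHull ℝ (V : Set (Fin d → ℝ))
  have hPc : Convex ℝ P := convex_convexHull ℝ _
  have h0P : (0 : Fin d → ℝ) ∈ P := subset_convexHull ℝ _ h0
  have hsub : convexHull ℝ (dilatedSum N V : Set (Fin (N * d) → ℝ)) ⊆
      {x | ∃ l : Fin N → ℝ, (∀ i, 0 ≤ l i) ∧ ∑ i, l i = N ∧ ∀ i, blockProj i x ∈ l i • P} := by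
    refine convexHull_min ?_ ?_
    · intro y hy
      obtain ⟨i, v, hv, rfl⟩ := mem_dilatedSum.1 hy
      refine ⟨fun j => if j = i then N else 0, fun j => ?_, by simp, fun j => ?_⟩
      · dsimp only
        split_ifs <;> simp
      · rw [blockProj_blockInl]
        dsimp only
        split_ifs
        · exact smul_mem_smul_set (subset_convexHull ℝ _ hv)
        · exact ⟨0, h0P, by simp⟩
    · rintro y ⟨l, hl, hls, hly⟩ z ⟨m, hm, hms, hmz⟩ a b ha hb hab
      refine ⟨fun i => a * l i + b * m i, fun i => ?_, ?_, fun i => ?_⟩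
      · have := hl i
        have := hm i
        positivity
      · rw [Finset.sum_add_distrib, ← Finset.mul_sum, ← Finset.mul_sum, hls, hms, ← add_mul, hab,
          one_mul]
      · rw [map_add, map_smul, map_smul, hPc.add_smul (mul_nonneg ha (hl i))
          (mul_nonneg hb (hm i)), mul_smul, mul_smul]
        exact add_mem_add (smul_mem_smul_set (hly i)) (smul_mem_smul_set (hmz i))
  obtain ⟨l, hl, hls, hlx⟩ := hsub hx
  have : ∃ i ∈ Finset.univ, l i ≤ (fun _ => (1 : ℝ)) i := by
    refine Finset.exists_le_of_sum_le ⟨⟨0, hN⟩, Finset.mem_univ _⟩ ?_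
    simp [hls]
  obtain ⟨i, -, hi⟩ := this
  obtain ⟨p, hp, hpx⟩ := hlx i
  exact ⟨i, hpx ▸ hPc.smul_mem_of_zero_mem h0P hp ⟨hl i, hi⟩⟩

lemma isCompact_convexHull_finset {ι : Type*} (V : Finset (ι → ℝ)) :
    IsCompact (convexHull ℝ (V : Set (ι → ℝ))) :=
  V.finite_toSet.isCompact_convexHull (𝕜 := ℝ)

/-- Direct sums of dilates turn a rational hollow polytope with the origin as a vertex into
a lattice hollow polytope with at least the same quotient of width and dimension. -/
lemma ofReal_latticeWidth_div_le_wp_div {d N : ℕ} (hd : 0 < d) (hN : 0 < N)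
    {V : Finset (Fin d → ℝ)} (h0 : 0 ∈ V) (hV : ∀ v ∈ V, ∀ i, ∃ k : ℤ, (N : ℝ) * v i = k)
    (hint : (interior (convexHull ℝ (V : Set (Fin d → ℝ)))).Nonempty)
    (hhol : ∀ z : Fin d → ℤ,
      (fun i => (z i : ℝ)) ∉ interior (convexHull ℝ (V : Set (Fin d → ℝ)))) :
    ENNReal.ofReal (latticeWidth (convexHull ℝ (V : Set (Fin d → ℝ)))) / (d : ℝ≥0∞) ≤
      wp (N * d) / ((N * d : ℕ) : ℝ≥0∞) := by
  set P := convexHull ℝ (V : Set (Fin d → ℝ))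
  have hPc : Convex ℝ P := convex_convexHull ℝ _
  have hPk : IsCompact P := isCompact_convexHull_finset V
  have hN' : (0 : ℝ) < N := by exact_mod_cast hN
  obtain ⟨k, hk⟩ := hint
  set Q := convexHull ℝ (dilatedSum N V : Set (Fin (N * d) → ℝ))
  have hQc : Convex ℝ Q := convex_convexHull ℝ _
  have hQk : IsCompact Q := isCompact_convexHull_finset _
  have hproj : ∀ i : Fin N, Continuous (blockProj (d := d) i) := fun i =>
    LinearMap.continuous_of_finiteDimensional _
  set kk : Fin (N * d) → ℝ := ∑ i : Fin N, blockInl i k with hkk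
  have hkki : ∀ i, blockProj i kk = k := fun i => by
    simp [hkk, map_sum, blockProj_blockInl]
  have hwidth : N * latticeWidth P ≤ latticeWidth Q := by
    have : Nonempty (Fin (N * d)) := ⟨⟨0, Nat.mul_pos hN hd⟩⟩
    refine le_latticeWidth_s16 fun f hf hf0 => ?_
    obtain ⟨i, hi⟩ : ∃ i : Fin N, f ∘ₗ blockInl i ≠ 0 := by
      by_contra! h
      refine hf0 (LinearMap.ext fun x => ?_)
      rw [← sum_blockInl_blockProj x, map_sum, LinearMap.zero_apply]
      exact Finset.sum_eq_zero fun i _ => LinearMap.congr_fun (h i) _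
    have hfi : ∀ v : Fin d → ℤ, ∃ k : ℤ, (f ∘ₗ blockInl i) (fun j => (v j : ℝ)) = (k : ℝ) := by
      intro v
      obtain ⟨m, hm⟩ := hf fun k =>
        if (finProdFinEquiv.symm k).1 = i then v (finProdFinEquiv.symm k).2 else 0
      refine ⟨m, hm ▸ congrArg f ?_⟩
      ext k
      simp only [blockInl, LinearMap.coe_mk, AddHom.coe_mk]
      split_ifs <;> simp
    refine (mul_le_mul_of_nonneg_left (latticeWidth_le hPk hfi hi) hN'.le).trans ?_
    exact mul_width_le_width hPk ⟨k, interior_subset hk⟩ hQk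
      (LinearMap.continuous_of_finiteDimensional _) (LinearMap.continuous_of_finiteDimensional _)
      (φ := fun v => blockInl i ((N : ℝ) • v)) (fun v hv => blockInl_mem_dilatedSum hv i)
      (b := 0) (by simp)
  have hle : ENNReal.ofReal (latticeWidth Q) ≤ wp (N * d) := by
    refine le_iSup₂_of_le (dilatedSum N V) ?_ (le_iSup₂_of_le ?_ ?_ le_rfl)
    · intro x hx j
      obtain ⟨i, v, hv, rfl⟩ := mem_dilatedSum.1 hx
      simp only [blockInl, LinearMap.coe_mk, AddHom.coe_mk]
      split_ifs
      · exact hV v hv _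
      · exact ⟨0, by simp⟩
    · have hopen : IsOpen {x : Fin (N * d) → ℝ | ∀ i : Fin N, blockProj i x ∈ interior P} := by
        rw [ofPred_forall]
        exact isOpen_iInter_of_finite fun i => isOpen_interior.preimage (hproj i)
      refine ⟨kk, interior_maximal (fun x hx => ?_) hopen fun i => (hkki i).symm ▸ hk⟩
      have hx' : ∑ i : Fin N, (N : ℝ)⁻¹ • blockInl i ((N : ℝ) • blockProj i x) = x := by
        conv_rhs => rw [← sum_blockInl_blockProj x]
        refine Finset.sum_congr rfl fun i _ => ?_
        rw [map_smul, inv_smul_smul₀ hN'.ne']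
      rw [← hx']
      refine hQc.sum_mem (fun i _ => by positivity) ?_ fun i _ =>
        blockInl_mem_dilatedSum (interior_subset (hx i)) i
      simp [hN'.ne']
    · intro z hz
      set x : Fin (N * d) → ℝ := fun i => (z i : ℝ)
      have hev : ∀ᶠ s : ℝ in 𝓝 0, x + s • (x - kk) ∈ Q := by
        have hcts : Continuous fun s : ℝ => x + s • (x - kk) := by fun_prop
        refine hcts.continuousAt.eventually_mem ?_
        simpa using mem_interior_iff_mem_nhds.1 hz
      obtain ⟨s, hsQ, hs⟩ := ((hev.filter_mono nhdsWithin_le_nhds).and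
        (self_mem_nhdsWithin : Ioi (0 : ℝ) ∈ 𝓝[>] 0)).exists
      obtain ⟨i, hi⟩ := exists_blockProj_mem hN h0 hsQ
      refine hhol (fun j => z (finProdFinEquiv (i, j))) ?_
      have := hPc.combo_interior_self_mem_interior hk hi (a := s / (1 + s)) (b := 1 / (1 + s))
        (by positivity) (by positivity) (by field_simp; ring)
      convert this using 1
      rw [map_add, map_smul, map_sub, hkki]
      ext j
      change x (finProdFinEquiv (i, j)) = s / (1 + s) * k j + 1 / (1 + s) *
        (x (finProdFinEquiv (i, j)) + s * (x (finProdFinEquiv (i, j)) - k j))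
      field_simp
      ring
  have hN0 : (N : ℝ≥0∞) ≠ 0 := by exact_mod_cast hN.ne'
  calc ENNReal.ofReal (latticeWidth P) / (d : ℝ≥0∞)
      = (N * ENNReal.ofReal (latticeWidth P)) / (N * d) :=
        (ENNReal.mul_div_mul_left _ _ hN0 (ENNReal.natCast_ne_top N)).symm
    _ = ENNReal.ofReal (N * latticeWidth P) / ((N * d : ℕ) : ℝ≥0∞) := by
        rw [ENNReal.ofReal_mul hN'.le, ENNReal.ofReal_natCast, Nat.cast_mul]
    _ ≤ wp (N * d) / ((N * d : ℕ) : ℝ≥0∞) := by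
        gcongr
        exact (ENNReal.ofReal_le_ofReal hwidth).trans hle

lemma ofReal_latticeWidth_div_le_iSup_wp_div {d : ℕ} (hd : 0 < d) {K : Set (Fin d → ℝ)}
    (hK : IsCompact K) (hconv : Convex ℝ K) (hint : (interior K).Nonempty)
    (hhol : ∀ z : Fin d → ℤ, (fun i => (z i : ℝ)) ∉ interior K) (h0 : 0 ∈ K) :
    ENNReal.ofReal (latticeWidth K) / (d : ℝ≥0∞) ≤
      ⨆ (d : ℕ) (_ : 0 < d), wp d / (d : ℝ≥0∞) := by
  classical
  have : Nonempty (Fin d) := ⟨⟨0, hd⟩⟩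
  obtain ⟨c, hc⟩ := hint
  refine ENNReal.le_of_forall_lt_one_mul_le fun s hs => ?_
  lift s to NNReal using hs.ne_top
  have hs' : (s : ℝ) < 1 := by exact_mod_cast hs
  have hCK : (fun x => (s : ℝ) • x + (1 - (s : ℝ)) • c) '' K ⊆ interior K := by
    rintro _ ⟨x, hx, rfl⟩
    exact hconv.combo_self_interior_mem_interior hx hc s.2 (by linarith) (by ring)
  obtain ⟨V, hV, hVK, hCV⟩ := exists_rational_subset_interior_convexHull isOpen_interior
    (hK.image (by fun_prop)) hCK
  have hVW : convexHull ℝ (V : Set (Fin d → ℝ)) ⊆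
      convexHull ℝ (insert 0 V : Finset (Fin d → ℝ)) :=
    convexHull_mono (by simp)
  have hWK : convexHull ℝ (insert 0 V : Finset (Fin d → ℝ)) ⊆ K := by
    refine convexHull_min ?_ hconv
    rw [Finset.coe_insert]
    exact insert_subset h0 (hVK.trans interior_subset)
  obtain ⟨N, hN, hNV⟩ := exists_common_denominator (insert 0 V) (by
    intro v hv i
    rcases Finset.mem_insert.1 hv with rfl | h
    · exact ⟨0, by simp⟩
    · exact hV v h i)
  have hw : s * latticeWidth K ≤
      latticeWidth (convexHull ℝ (insert 0 V : Finset (Fin d → ℝ)) : Set (Fin d → ℝ)) :=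
    mul_latticeWidth_le hK ⟨0, h0⟩ (isCompact_convexHull_finset _) s.2 fun x hx =>
      hVW (interior_subset (hCV ⟨x, hx, rfl⟩))
  have hmain := ofReal_latticeWidth_div_le_wp_div hd hN (Finset.mem_insert_self 0 V) hNV
    ⟨_, interior_mono hVW (hCV ⟨0, h0, rfl⟩)⟩ fun z hz => hhol z (interior_mono hWK hz)
  refine le_trans ?_ (hmain.trans (le_iSup₂_of_le (N * d) (Nat.mul_pos hN hd) le_rfl))
  rw [← mul_div_assoc]
  gcongr
  rw [← ENNReal.ofReal_coe_nnreal, ← ENNReal.ofReal_mul s.coe_nonneg]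
  exact ENNReal.ofReal_le_ofReal hw

end

theorem sup_wc_div_eq_sup_wp_div :
    (⨆ (d : ℕ) (_ : 0 < d), wc d / (d : ℝ≥0∞)) =
      (⨆ (d : ℕ) (_ : 0 < d), wp d / (d : ℝ≥0∞)) := by
  refine le_antisymm (iSup₂_le fun d hd => ?_) (iSup₂_mono fun d _ => ?_)
  · have : Nonempty (Fin d) := ⟨⟨0, hd⟩⟩
    rw [wc]
    simp only [ENNReal.iSup_div]
    refine iSup_le fun K => iSup_le fun hK => iSup_le fun hconv => iSup_le fun hint =>
      iSup_le fun hhol => ?_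
    obtain ⟨L, hL, hLconv, hLint, hLhol, h0, hle⟩ := exists_hollow_zero_mem hK hconv hint hhol
    refine le_trans ?_ (ofReal_latticeWidth_div_le_iSup_wp_div hd hL hLconv hLint hLhol h0)
    gcongr
  · gcongr
    exact iSup_le fun V => iSup_le fun _ => iSup_le fun hint => iSup_le fun hhol =>
      le_iSup_of_le _ (le_iSup₂_of_le (isCompact_convexHull_finset V) (convex_convexHull ℝ _)
        (le_iSup₂_of_le hint hhol le_rfl))
end

section
/- One has sup_{d≥1} w_p(d)/d ≥ (2 + √2)/3 and sup_{d≥1} w_s(d)/d ≥ 102/101 (suprema taken in [0,∞]). -/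
open Set ENNReal

/-- The vector of `ℝ^(m * d) = (ℝ^d)^m` with `v` in the block `j` and zeros elsewhere. -/
def blockVec {m d : ℕ} (j : Fin m) (v : Fin d → ℝ) : Fin (m * d) → ℝ := fun c =>
  if (finProdFinEquiv.symm c).1 = j then v (finProdFinEquiv.symm c).2 else 0

/-- The linear functional on `ℝ^(m * d) = (ℝ^d)^m` with coefficients `A j` on the block `j`. -/
def blockFun {m d : ℕ} (A : Fin m → Fin d → ℝ) : (Fin (m * d) → ℝ) →ₗ[ℝ] ℝ where
  toFun x := ∑ j, ∑ i, A j i * x (finProdFinEquiv (j, i))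
  map_add' x y := by simp [mul_add, Finset.sum_add_distrib]
  map_smul' r x := by simp [Finset.mul_sum, mul_left_comm]

theorem blockFun_apply {m d : ℕ} (A : Fin m → Fin d → ℝ) (x : Fin (m * d) → ℝ) :
    blockFun A x = ∑ j, ∑ i, A j i * x (finProdFinEquiv (j, i)) := rfl

theorem blockFun_blockVec {m d : ℕ} (A : Fin m → Fin d → ℝ) (j : Fin m) (v : Fin d → ℝ) :
    blockFun A (blockVec j v) = ∑ i, A j i * v i := by
  rw [blockFun_apply, Finset.sum_eq_single j] <;> simp +contextual [blockVec]

theorem eq_blockFun {m d : ℕ} (f : (Fin (m * d) → ℝ) →ₗ[ℝ] ℝ) :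
    f = blockFun fun j i => f (Pi.single (finProdFinEquiv (j, i)) 1) := by
  ext c
  obtain ⟨⟨j, i⟩, rfl⟩ := finProdFinEquiv.surjective c
  simp only [LinearMap.coe_comp, Function.comp_apply, LinearMap.coe_single, blockFun_apply]
  rw [Finset.sum_eq_single j, Finset.sum_eq_single i]
  · simp
  · intro b _ hb
    simp [hb]
  · simp
  · intro b _ hb
    simp [hb]
  · simp

/-- The origin and the `m`-fold dilates of the points of `V` in each of the `m` blocks; the convex
hull is the `m`-th dilate of the direct sum of `m` copies of the hull of `V` and the origin. -/
def directSumPts (m : ℕ) {d : ℕ} {κ : Type*} (V : κ → Fin d → ℚ) : Set (Fin (m * d) → ℝ) :=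
  insert 0 (range fun q : Fin m × κ => blockVec q.1 fun i => (m : ℝ) * V q.2 i)

theorem directSumPts_finite (m : ℕ) {d : ℕ} {κ : Type*} [Finite κ] (V : κ → Fin d → ℚ) :
    (directSumPts m V).Finite :=
  (finite_range _).insert 0

theorem directSumPts_integral {m d : ℕ} {κ : Type*} {V : κ → Fin d → ℚ}
    (hV : ∀ k i, ∃ z : ℤ, (m : ℚ) * V k i = z) :
    ∀ v ∈ directSumPts m V, ∀ i, ∃ z : ℤ, v i = (z : ℝ) := by
  rintro v (rfl | ⟨⟨j, k⟩, rfl⟩) i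
  · exact ⟨0, by simp⟩
  · by_cases h : (finProdFinEquiv.symm i).1 = j
    · obtain ⟨z, hz⟩ := hV k (finProdFinEquiv.symm i).2
      refine ⟨z, ?_⟩
      simp only [blockVec, if_pos h]
      exact_mod_cast hz
    · exact ⟨0, by simp only [blockVec, if_neg h, Int.cast_zero]⟩

theorem lt_of_mem_interior_convexHull {n : ℕ} {S : Set (Fin n → ℝ)} {F : (Fin n → ℝ) →ₗ[ℝ] ℝ}
    (hF : F ≠ 0) {c : ℝ} (hS : ∀ v ∈ S, F v ≤ c) {x : Fin n → ℝ}
    (hx : x ∈ interior (convexHull ℝ S)) : F x < c := by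
  have hsub : convexHull ℝ S ⊆ F ⁻¹' Iic c :=
    convexHull_min hS ((convex_Iic c).linear_preimage F)
  have hopen : IsOpenMap F := F.isOpenMap_of_finiteDimensional (LinearMap.surjective hF)
  have hsub' : F '' interior (convexHull ℝ S) ⊆ Iic c :=
    image_subset_iff.2 (interior_subset.trans hsub)
  have := interior_maximal hsub' (hopen _ isOpen_interior) (mem_image_of_mem F hx)
  rwa [interior_Iic] at this

/-- Hollowness of the direct sum, from inequalities valid for `V` which cut off every lattice
point: homogeneous ones, or ones with a positive right-hand side. -/
theorem directSumPts_hollow {m d : ℕ} (hm : 0 < m) {κ : Type*} {V : κ → Fin d → ℚ}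
    (hV : ∀ z : Fin d → ℤ,
      (∃ a : Fin d → ℚ, a ≠ 0 ∧ (∀ k, ∑ i, a i * V k i ≤ 0) ∧ 0 ≤ ∑ i, a i * z i) ∨
      ∃ b : Fin d → ℚ, ∃ c : ℚ, 0 < c ∧ (∀ k, ∑ i, b i * V k i ≤ c) ∧ c ≤ ∑ i, b i * z i)
    (z : Fin (m * d) → ℤ) :
    (fun i => (z i : ℝ)) ∉ interior (convexHull ℝ (directSumPts m V)) := by
  intro hz
  have key : ∀ j : Fin m, ∃ b : Fin d → ℝ, (∀ k, ∑ i, b i * V k i ≤ 1) ∧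
      1 ≤ ∑ i, b i * z (finProdFinEquiv (j, i)) := by
    intro j
    rcases hV (fun i => z (finProdFinEquiv (j, i))) with ⟨a, ha, haV, haz⟩ | ⟨b, c, hc, hb, hbz⟩
    · exfalso
      have hval : ∀ x : Fin (m * d) → ℝ, blockFun (Pi.single j fun i => (a i : ℝ)) x =
          ∑ i, (a i : ℝ) * x (finProdFinEquiv (j, i)) := by
        intro x
        rw [blockFun_apply, Finset.sum_eq_single j] <;> simp +contextual
      have hlt := lt_of_mem_interior_convexHull (F := blockFun (Pi.single j fun i => (a i : ℝ)))
        (c := 0) ?_ ?_ hz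
      · rw [hval] at hlt
        exact absurd hlt (not_lt.2 (by exact_mod_cast haz))
      · intro h0
        apply ha
        ext i
        have := congrArg (fun F => F (blockVec j (Pi.single i 1))) h0
        simpa [blockFun_blockVec, Pi.single_apply] using this
      · rintro v (rfl | ⟨⟨j', k⟩, rfl⟩)
        · simp
        · simp only [blockFun_blockVec]
          by_cases h : j' = j
          · subst h
            have h1 : (∑ i, (a i : ℝ) * V k i) ≤ 0 := by exact_mod_cast haV k
            have h2 : ∑ i, (a i : ℝ) * (m * V k i) = m * ∑ i, (a i : ℝ) * V k i := by
              rw [Finset.mul_sum]; exact Finset.sum_congr rfl fun i _ => by ring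
            simp only [Pi.single_eq_same, h2]
            exact mul_nonpos_of_nonneg_of_nonpos (Nat.cast_nonneg m) h1
          · simp [h]
    · have hc' : (0 : ℝ) < c := by exact_mod_cast hc
      have hsum : ∀ y : Fin d → ℝ, ∑ i, (b i : ℝ) / c * y i = (∑ i, (b i : ℝ) * y i) / c := by
        intro y
        rw [Finset.sum_div]; exact Finset.sum_congr rfl fun i _ => by ring
      refine ⟨fun i => b i / c, fun k => ?_, ?_⟩
      · rw [hsum, div_le_one hc']
        exact_mod_cast hb k
      · rw [hsum, one_le_div hc']
        exact_mod_cast hbz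
  choose B hB hBz using key
  have hge : (m : ℝ) ≤ blockFun B fun i => (z i : ℝ) := by
    rw [blockFun_apply]
    calc (m : ℝ) = ∑ _j : Fin m, (1 : ℝ) := by simp
      _ ≤ _ := Finset.sum_le_sum fun j _ => hBz j
  refine absurd (lt_of_mem_interior_convexHull (c := m) ?_ ?_ hz) (not_lt.2 hge)
  · intro h0
    rw [h0, LinearMap.zero_apply] at hge
    exact absurd hge (not_le.2 (by exact_mod_cast hm))
  · rintro v (rfl | ⟨⟨j, k⟩, rfl⟩)
    · simp
    · simp only [blockFun_blockVec]
      have h2 : ∑ i, B j i * (m * V k i) = m * ∑ i, B j i * V k i := by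
        rw [Finset.mul_sum]; exact Finset.sum_congr rfl fun i _ => by ring
      rw [h2]
      exact mul_le_of_le_one_right (Nat.cast_nonneg m) (hB j k)

theorem le_latticeWidth_directSumPts {m d : ℕ} (hm : 0 < m) (hd : 0 < d) {κ : Type*} [Finite κ]
    {V : κ → Fin d → ℚ} {w : ℚ}
    (hw : ∀ a : Fin d → ℤ, a ≠ 0 → ∃ u ∈ insert 0 (range V), ∃ v ∈ insert 0 (range V),
      w ≤ ∑ i, a i * u i - ∑ i, a i * v i) :
    (m : ℝ) * w ≤ latticeWidth (convexHull ℝ (directSumPts m V)) := by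
  apply le_csInf
  · let c : Fin (m * d) := finProdFinEquiv (⟨0, hm⟩, ⟨0, hd⟩)
    refine ⟨_, LinearMap.proj c, fun v => ⟨v c, rfl⟩, ?_, rfl⟩
    intro h
    simpa using congrArg (fun F => F (Pi.single c 1)) h
  · rintro _ ⟨f, hf, hf0, rfl⟩
    have hint : ∀ c, ∃ k : ℤ, f (Pi.single c 1) = k := by
      intro c
      obtain ⟨k, hk⟩ := hf (Pi.single c 1)
      refine ⟨k, ?_⟩
      rw [← hk]
      congr 1
      ext i
      by_cases h : i = c <;> simp [h]
    choose a ha using hint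
    have hfa := eq_blockFun f
    simp only [ha] at hfa
    obtain ⟨j, hj⟩ : ∃ j : Fin m, (fun i => a (finProdFinEquiv (j, i))) ≠ 0 := by
      by_contra! h
      apply hf0
      rw [hfa]
      ext x
      simp [blockFun_apply, fun j i => congrFun (h j) i]
    have hval : ∀ u ∈ insert 0 (range V), ∃ U ∈ directSumPts m V,
        f U = m * ((∑ i, a (finProdFinEquiv (j, i)) * u i : ℚ) : ℝ) := by
      rintro u (rfl | ⟨k, rfl⟩)
      · exact ⟨0, mem_insert _ _, by simp⟩
      · refine ⟨_, mem_insert_of_mem _ ⟨(j, k), rfl⟩, ?_⟩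
        rw [hfa, blockFun_blockVec]
        push_cast
        rw [Finset.mul_sum]
        exact Finset.sum_congr rfl fun i _ => by ring
    obtain ⟨u, hu, v, hv, huv⟩ := hw _ hj
    obtain ⟨U, hU, hfU⟩ := hval u hu
    obtain ⟨W, hW, hfW⟩ := hval v hv
    have hcpt : IsCompact (f '' convexHull ℝ (directSumPts m V)) :=
      ((directSumPts_finite m V).isCompact_convexHull ℝ).image f.continuous_of_finiteDimensional
    have h1 := le_csSup hcpt.bddAbove (mem_image_of_mem f (subset_convexHull ℝ _ hU))
    have h2 := csInf_le hcpt.bddBelow (mem_image_of_mem f (subset_convexHull ℝ _ hW))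
    have h3 : (m : ℝ) * w ≤ f U - f W := by
      rw [hfU, hfW, ← mul_sub]
      exact mul_le_mul_of_nonneg_left (by exact_mod_cast huv) (Nat.cast_nonneg m)
    linarith

theorem affineSpan_directSumPts {m d : ℕ} (hm : 0 < m) {κ : Type*} {V : κ → Fin d → ℚ}
    (hV : ∀ a : Fin d → ℝ, (∀ k, ∑ i, a i * V k i = 0) → a = 0) :
    affineSpan ℝ (directSumPts m V) = ⊤ := by
  have hspan : Submodule.span ℝ (directSumPts m V) = ⊤ := by
    by_contra h
    obtain ⟨f, hf, hle⟩ := Submodule.exists_le_ker_of_lt_top _ (lt_top_iff_ne_top.2 h)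
    apply hf
    have hfa := eq_blockFun f
    have : (fun (j : Fin m) (i : Fin d) => f (Pi.single (finProdFinEquiv (j, i)) 1)) = 0 := by
      ext j : 1
      apply hV
      intro k
      have := hle (Submodule.subset_span (mem_insert_of_mem _ ⟨(j, k), rfl⟩))
      rw [LinearMap.mem_ker, hfa, blockFun_blockVec] at this
      have hm' : (m : ℝ) ≠ 0 := by exact_mod_cast hm.ne'
      apply mul_left_cancel₀ hm'
      rw [mul_zero, Finset.mul_sum, ← this]
      exact Finset.sum_congr rfl fun i _ => by ring
    rw [hfa, this]
    ext x
    simp [blockFun_apply]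
  rw [directSumPts] at hspan ⊢
  rw [AffineSubspace.affineSpan_eq_top_iff_vectorSpan_eq_top_of_nonempty _ _ _
    ⟨_, mem_insert _ _⟩, vectorSpan_eq_span_vsub_set_right ℝ (mem_insert _ _)]
  simpa using hspan

theorem ofReal_mul_le_wp {m d : ℕ} (hm : 0 < m) (hd : 0 < d) {κ : Type*} [Finite κ]
    {V : κ → Fin d → ℚ} (hint : ∀ k i, ∃ z : ℤ, (m : ℚ) * V k i = z) {w : ℚ}
    (hspan : ∀ a : Fin d → ℝ, (∀ k, ∑ i, a i * V k i = 0) → a = 0)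
    (hhollow : ∀ z : Fin d → ℤ,
      (∃ a : Fin d → ℚ, a ≠ 0 ∧ (∀ k, ∑ i, a i * V k i ≤ 0) ∧ 0 ≤ ∑ i, a i * z i) ∨
      ∃ b : Fin d → ℚ, ∃ c : ℚ, 0 < c ∧ (∀ k, ∑ i, b i * V k i ≤ c) ∧ c ≤ ∑ i, b i * z i)
    (hw : ∀ a : Fin d → ℤ, a ≠ 0 → ∃ u ∈ insert 0 (range V), ∃ v ∈ insert 0 (range V),
      w ≤ ∑ i, a i * u i - ∑ i, a i * v i) :
    ENNReal.ofReal (m * w) ≤ wp (m * d) := by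
  have hfin := directSumPts_finite m V
  refine le_trans ?_ (le_iSup _ hfin.toFinset)
  simp only [Finite.coe_toFinset, Finite.mem_toFinset]
  refine le_trans ?_ (le_iSup₂_of_le (directSumPts_integral hint) ?_ (le_iSup _
    (directSumPts_hollow hm hhollow)))
  · exact ENNReal.ofReal_le_ofReal (le_latticeWidth_directSumPts hm hd hw)
  · exact interior_convexHull_nonempty_iff_affineSpan_eq_top.2 (affineSpan_directSumPts hm hspan)

theorem ofReal_mul_le_ws {m d : ℕ} (hm : 0 < m) (hd : 0 < d)
    {V : Fin d → Fin d → ℚ} (hint : ∀ k i, ∃ z : ℤ, (m : ℚ) * V k i = z) {w : ℚ}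
    (hspan : ∀ a : Fin d → ℝ, (∀ k, ∑ i, a i * V k i = 0) → a = 0)
    (hhollow : ∀ z : Fin d → ℤ,
      (∃ a : Fin d → ℚ, a ≠ 0 ∧ (∀ k, ∑ i, a i * V k i ≤ 0) ∧ 0 ≤ ∑ i, a i * z i) ∨
      ∃ b : Fin d → ℚ, ∃ c : ℚ, 0 < c ∧ (∀ k, ∑ i, b i * V k i ≤ c) ∧ c ≤ ∑ i, b i * z i)
    (hw : ∀ a : Fin d → ℤ, a ≠ 0 → ∃ u ∈ insert 0 (range V), ∃ v ∈ insert 0 (range V),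
      w ≤ ∑ i, a i * u i - ∑ i, a i * v i) :
    ENNReal.ofReal (m * w) ≤ ws (m * d) := by
  let v : Fin (m * d + 1) → (Fin (m * d) → ℝ) := Fin.cons 0 fun c =>
    blockVec (finProdFinEquiv.symm c).1 fun i => (m : ℝ) * V (finProdFinEquiv.symm c).2 i
  have hv : range v = directSumPts m V := by
    rw [directSumPts, Fin.range_cons]
    congr 1
    exact finProdFinEquiv.symm.surjective.range_comp
      fun q : Fin m × Fin d => blockVec q.1 fun i => (m : ℝ) * V q.2 i
  have hind : AffineIndependent ℝ v := by
    rw [affineIndependent_iff_finrank_vectorSpan_eq ℝ v (Fintype.card_fin _), hv,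
      ← direction_affineSpan, affineSpan_directSumPts hm hspan,
      AffineSubspace.direction_top, finrank_top, Module.finrank_fin_fun]
  refine le_trans ?_ (le_iSup₂_of_le v hind (le_iSup₂_of_le ?_ ?_ le_rfl))
  · rw [hv]
    exact ENNReal.ofReal_le_ofReal (le_latticeWidth_directSumPts hm hd hw)
  · intro j
    exact directSumPts_integral hint _ (hv ▸ mem_range_self j)
  · rw [hv]
    exact directSumPts_hollow hm hhollow

/-- The nonzero vertices of the `102/101`-dilate of an empty lattice 4-simplex of normalized
volume `101` and width `4`, a vertex of which is the origin. -/
def simplexVerts : Fin 4 → Fin 4 → ℚ :=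
  ![![102 / 101, 0, 0, 0], ![0, 102 / 101, 0, 0], ![0, 0, 102 / 101, 0],
    ![102 / 101 * 6, 102 / 101 * 14, 102 / 101 * 17, 102]]

theorem simplexVerts_hollow (z : Fin 4 → ℤ) :
    (∃ a : Fin 4 → ℚ, a ≠ 0 ∧ (∀ k, ∑ i, a i * simplexVerts k i ≤ 0) ∧ 0 ≤ ∑ i, a i * z i) ∨
    ∃ b : Fin 4 → ℚ, ∃ c : ℚ, 0 < c ∧ (∀ k, ∑ i, b i * simplexVerts k i ≤ c) ∧
      c ≤ ∑ i, b i * z i := by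
  have ne (a : Fin 4 → ℚ) (h : a 3 ≠ 0) : a ≠ 0 := fun h0 => h (by simp [h0])
  by_cases h0 : 101 * z 0 ≤ 6 * z 3
  · refine .inl ⟨![-101, 0, 0, 6], ne _ (by simp), ?_, ?_⟩
    · simp [Fin.forall_fin_succ, Fin.sum_univ_four, simplexVerts]; norm_num
    · simp [Fin.sum_univ_four]; exact_mod_cast h0
  by_cases h1 : 101 * z 1 ≤ 14 * z 3
  · refine .inl ⟨![0, -101, 0, 14], ne _ (by simp), ?_, ?_⟩
    · simp [Fin.forall_fin_succ, Fin.sum_univ_four, simplexVerts]; norm_num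
    · simp [Fin.sum_univ_four]; exact_mod_cast h1
  by_cases h2 : 101 * z 2 ≤ 17 * z 3
  · refine .inl ⟨![0, 0, -101, 17], ne _ (by simp), ?_, ?_⟩
    · simp [Fin.forall_fin_succ, Fin.sum_univ_four, simplexVerts]; norm_num
    · simp [Fin.sum_univ_four]; exact_mod_cast h2
  by_cases h3 : z 3 ≤ 0
  · refine .inl ⟨![0, 0, 0, -1], ne _ (by simp), ?_, ?_⟩
    · simp [Fin.forall_fin_succ, Fin.sum_univ_four, simplexVerts]
    · simp [Fin.sum_univ_four]; exact_mod_cast h3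
  refine .inr ⟨![101, 101, 101, -36], 102, by norm_num, ?_, ?_⟩
  · simp [Fin.forall_fin_succ, Fin.sum_univ_four, simplexVerts]; norm_num
  · have key : 102 ≤ 101 * z 0 + 101 * z 1 + 101 * z 2 - 36 * z 3 := by
      by_cases h4 : 101 ≤ z 3
      · omega
      · generalize z 3 = y at *
        push Not at h3 h4
        interval_cases y <;> omega
    simp [Fin.sum_univ_four]
    have : (102 : ℚ) ≤ 101 * z 0 + 101 * z 1 + 101 * z 2 - 36 * z 3 := by exact_mod_cast key
    linarith

theorem simplexVerts_width (a : Fin 4 → ℤ) (ha : a ≠ 0) :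
    ∃ u ∈ insert 0 (range simplexVerts), ∃ v ∈ insert 0 (range simplexVerts),
      (408 / 101 : ℚ) ≤ ∑ i, a i * u i - ∑ i, a i * v i := by
  by_contra! h
  have h' : ∀ k, (∑ i, a i * simplexVerts k i < 408 / 101 ∧
      -∑ i, a i * simplexVerts k i < 408 / 101) ∧ ∀ l,
      ∑ i, a i * simplexVerts k i - ∑ i, a i * simplexVerts l i < 408 / 101 := fun k =>
    ⟨⟨by simpa using h _ (mem_insert_of_mem _ ⟨k, rfl⟩) 0 (mem_insert _ _),
      by simpa using h 0 (mem_insert _ _) _ (mem_insert_of_mem _ ⟨k, rfl⟩)⟩,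
      fun l => h _ (mem_insert_of_mem _ ⟨k, rfl⟩) _ (mem_insert_of_mem _ ⟨l, rfl⟩)⟩
  have hval : ∀ k, ∑ i, a i * simplexVerts k i = 102 / 101 *
      ((![a 0, a 1, a 2, 6 * a 0 + 14 * a 1 + 17 * a 2 + 101 * a 3] k : ℤ) : ℚ) := by
    simp [Fin.forall_fin_succ, Fin.sum_univ_four, simplexVerts, mul_comm]
    ring
  simp only [hval] at h'
  set b : Fin 4 → ℤ := ![a 0, a 1, a 2, 6 * a 0 + 14 * a 1 + 17 * a 2 + 101 * a 3] with hb
  have hint : ∀ k, (b k < 4 ∧ -b k < 4) ∧ ∀ l, b k - b l < 4 := by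
    intro k
    obtain ⟨⟨h1, h2⟩, h3⟩ := h' k
    refine ⟨⟨?_, ?_⟩, fun l => ?_⟩
    · have : (b k : ℚ) < 4 := by linarith
      exact_mod_cast this
    · have : -(b k : ℚ) < 4 := by linarith
      exact_mod_cast this
    · have : (b k : ℚ) - b l < 4 := by linarith [h3 l]
      exact_mod_cast this
  simp [Fin.forall_fin_succ, hb] at hint
  obtain ⟨h0, h1, h2, h3⟩ := hint
  apply ha
  have : a 0 = 0 ∧ a 1 = 0 ∧ a 2 = 0 ∧ a 3 = 0 := by
    have l0 : -4 < a 0 := by omega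
    have l1 : -4 < a 1 := by omega
    have l2 : -4 < a 2 := by omega
    have u0 : a 0 < 4 := by omega
    have u1 : a 1 < 4 := by omega
    have u2 : a 2 < 4 := by omega
    clear h h' hval hb b ha
    generalize a 0 = x at *
    generalize a 1 = y at *
    generalize a 2 = z at *
    generalize a 3 = t at *
    interval_cases x <;> interval_cases y <;> first | (exfalso; omega) |
      (interval_cases z <;> omega)
  ext i
  fin_cases i <;> simp [this]

theorem simplexVerts_span (a : Fin 4 → ℝ) (h : ∀ k, ∑ i, a i * simplexVerts k i = 0) : a = 0 := by
  simp [Fin.forall_fin_succ, Fin.sum_univ_four, simplexVerts] at h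
  obtain ⟨h0, h1, h2, h3⟩ := h
  ext i
  fin_cases i <;> simp_all

theorem le_ws_404 : (408 : ℝ≥0∞) ≤ ws 404 := by
  have := ofReal_mul_le_ws (m := 101) (d := 4) (w := 408 / 101) (by norm_num) (by norm_num)
    (V := simplexVerts) ?_ simplexVerts_span simplexVerts_hollow simplexVerts_width
  · norm_num at this
    exact this
  · have : ∀ k i, (101 * simplexVerts k i).den = 1 := by
      simp [Fin.forall_fin_succ, simplexVerts]; norm_num
    exact fun k i => ⟨_, (Rat.den_eq_one_iff _).1 (this k i) |>.symm⟩

/-- Vertices of tetrahedra approximating, as `t → √2`, a hollow tetrahedron of width `2 + √2` with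
respect to the affine lattice of the points with odd coordinates with sum `1` modulo `4`. -/
def tetraXYZ (t : ℚ) : Fin 4 → Fin 3 → ℚ :=
  ![![2 + t, t, 2 + t], ![-t, 2 + t, -(2 + t)], ![-(2 + t), -t, 2 + t], ![t, -(2 + t), -(2 + t)]]

/-- The tetrahedron `tetraXYZ t`, dilated from its last vertex by the factor `q`, and translated
by the lattice point `(-1, 1, 1)`, which becomes the origin. -/
def tetraShift (t q : ℚ) (k : Fin 4) (i : Fin 3) : ℚ :=
  tetraXYZ t 3 i + q * (tetraXYZ t k i - tetraXYZ t 3 i) - ![-1, 1, 1] i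

/-- The tetrahedron `tetraShift t q` in coordinates for which the lattice is `ℤ^3`. -/
def tetraVerts (t q : ℚ) (k : Fin 4) : Fin 3 → ℚ :=
  ![(tetraShift t q k 1 + tetraShift t q k 2 - tetraShift t q k 0) / 4,
    (tetraShift t q k 0 + tetraShift t q k 2 - tetraShift t q k 1) / 4,
    (tetraShift t q k 0 + tetraShift t q k 1 - tetraShift t q k 2) / 4]

theorem tetraVerts_width {t q : ℚ} (ht : 0 < t) (hq : 1 ≤ q) (a : Fin 3 → ℤ) (ha : a ≠ 0) :
    ∃ u ∈ insert 0 (range (tetraVerts t q)), ∃ v ∈ insert 0 (range (tetraVerts t q)),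
      2 + t ≤ ∑ i, a i * u i - ∑ i, a i * v i := by
  by_contra! h
  have h' : ∀ k l, ∑ i, a i * tetraVerts t q k i - ∑ i, a i * tetraVerts t q l i < 2 + t :=
    fun k l => h _ (mem_insert_of_mem _ ⟨k, rfl⟩) _ (mem_insert_of_mem _ ⟨l, rfl⟩)
  obtain ⟨x, hx⟩ : ∃ x, x = a 1 + a 2 - a 0 := ⟨_, rfl⟩
  obtain ⟨y, hy⟩ : ∃ y, y = a 0 + a 2 - a 1 := ⟨_, rfl⟩
  obtain ⟨z, hz⟩ : ∃ z, z = a 0 + a 1 - a 2 := ⟨_, rfl⟩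
  have hdiff : ∀ k l, x * (tetraXYZ t k 0 - tetraXYZ t l 0) +
      y * (tetraXYZ t k 1 - tetraXYZ t l 1) +
      z * (tetraXYZ t k 2 - tetraXYZ t l 2) < 4 * (2 + t) := by
    intro k l
    have h1 := h' k l
    simp only [Fin.sum_univ_three, tetraVerts, tetraShift, Matrix.cons_val] at h1
    have h2 : q * (x * (tetraXYZ t k 0 - tetraXYZ t l 0) +
      y * (tetraXYZ t k 1 - tetraXYZ t l 1) +
      z * (tetraXYZ t k 2 - tetraXYZ t l 2)) < 4 * (2 + t) := by
      rw [hx, hy, hz]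
      push_cast
      linarith
    by_contra! h3
    nlinarith
  have hAC := hdiff 0 2
  have hCA := hdiff 2 0
  have hBD := hdiff 1 3
  have hDB := hdiff 3 1
  have hAB := hdiff 0 1
  have hBA := hdiff 1 0
  have hAD := hdiff 0 3
  have hDA := hdiff 3 0
  have hCB := hdiff 2 1
  have hBC := hdiff 1 2
  have hCD := hdiff 2 3
  have hDC := hdiff 3 2
  simp only [tetraXYZ, Matrix.cons_val] at hAC hCA hBD hDB hAB hBA hAD hDA hCB hBC hCD hDC
  have hz1 : z < 2 := by
    have : (z : ℚ) < 2 := by by_contra! hc; nlinarith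
    exact_mod_cast this
  have hz2 : -2 < z := by
    have : -2 < (z : ℚ) := by by_contra! hc; nlinarith
    exact_mod_cast this
  have hx1 : x < 3 := by
    have : (x : ℚ) < 3 := by by_contra! hc; nlinarith [sq_nonneg t]
    exact_mod_cast this
  have hx2 : -3 < x := by
    have : -3 < (x : ℚ) := by by_contra! hc; nlinarith [sq_nonneg t]
    exact_mod_cast this
  have hy1 : y < 3 := by
    have : (y : ℚ) < 3 := by by_contra! hc; nlinarith [sq_nonneg t]
    exact_mod_cast this
  have hy2 : -3 < y := by
    have : -3 < (y : ℚ) := by by_contra! hc; nlinarith [sq_nonneg t]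
    exact_mod_cast this
  have hne : ¬ (x = 0 ∧ y = 0 ∧ z = 0) := by
    rintro ⟨rfl, rfl, rfl⟩
    apply ha
    ext i
    fin_cases i <;> simp <;> omega
  have hxy : (x - y) % 2 = 0 := by omega
  have hxz : (x - z) % 2 = 0 := by omega
  clear h h' hdiff hx hy hz
  interval_cases z <;> interval_cases x <;> first | (exfalso; omega) |
    (interval_cases y <;> first | (exfalso; omega) | (push_cast at *; linarith))

theorem tetraVerts_span {t q : ℚ} (ht : 0 < t) (hq : 1 ≤ q) (a : Fin 3 → ℝ)
    (h : ∀ k, ∑ i, a i * tetraVerts t q k i = 0) : a = 0 := by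
  have ht' : (0 : ℝ) < t := by exact_mod_cast ht
  have hq' : (q : ℝ) ≠ 0 := by
    have : (0 : ℝ) < q := by exact_mod_cast one_pos.trans_le hq
    exact this.ne'
  obtain ⟨x, hx⟩ : ∃ x, x = a 1 + a 2 - a 0 := ⟨_, rfl⟩
  obtain ⟨y, hy⟩ : ∃ y, y = a 0 + a 2 - a 1 := ⟨_, rfl⟩
  obtain ⟨z, hz⟩ : ∃ z, z = a 0 + a 1 - a 2 := ⟨_, rfl⟩
  have hdiff : ∀ k l, x * ((tetraXYZ t k 0 : ℝ) - tetraXYZ t l 0) +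
      y * ((tetraXYZ t k 1 : ℝ) - tetraXYZ t l 1) +
      z * ((tetraXYZ t k 2 : ℝ) - tetraXYZ t l 2) = 0 := by
    intro k l
    have h1 := h k
    have h2 := h l
    simp only [Fin.sum_univ_three, tetraVerts, tetraShift, Matrix.cons_val] at h1 h2
    push_cast at h1 h2
    apply mul_left_cancel₀ hq'
    rw [hx, hy, hz]
    linear_combination 4 * h1 - 4 * h2
  have hAC := hdiff 0 2
  have hBD := hdiff 1 3
  have hAB := hdiff 0 1
  have hCD := hdiff 2 3
  simp only [tetraXYZ, Matrix.cons_val] at hAC hBD hAB hCD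
  push_cast at hAC hBD hAB hCD
  have hpos : ((2 + t : ℝ) ^ 2 + t ^ 2) ≠ 0 := by positivity
  have hx0 : x = 0 := by
    apply mul_left_cancel₀ hpos
    linear_combination (2 + t) / 2 * hAC - t / 2 * hBD
  have hy0 : y = 0 := by
    apply mul_left_cancel₀ hpos
    linear_combination t / 2 * hAC + (2 + t) / 2 * hBD
  have hz0 : z = 0 := by
    have : (2 + t : ℝ) ≠ 0 := by positivity
    apply mul_left_cancel₀ this
    linear_combination hAB / 4 + hCD / 4
  ext i
  fin_cases i <;> simp <;> linarith

/-- No point of the affine lattice satisfies the facet inequalities strictly. -/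
theorem tetraXYZ_not_interior {t w s : ℚ} (ht1 : 1.414 < t) (ht2 : t ^ 2 < 2) (hw : w = 2 + t)
    (hs : s = t ^ 2 + 2 * t + 2) {X Y Z : ℤ} (hX : X % 2 = 1) (hY : Y % 2 = 1)
    (hmod : (X + Y + Z) % 4 = 1)
    (h0 : -(t * w) * X + w ^ 2 * Y + s * Z < t * w + w ^ 2 + s)
    (h1 : t * w * Y + w ^ 2 * X - s * Z < s * w)
    (h2 : t * w * X - w ^ 2 * Y + s * Z < s * w)
    (h3 : -(t * w) * Y - w ^ 2 * X - s * Z < s * w) : False := by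
  have ht3 : t < 1.415 := by nlinarith
  have ht4 : t ^ 3 ≤ 2 * t := by nlinarith
  have ht5 : 1.414 * t ≤ t ^ 2 := by nlinarith
  have ht6 : 1.414 * t ^ 2 ≤ t ^ 3 := by nlinarith
  have hslack : t * w + w ^ 2 + s < s * w + 0.1 := by
    rw [hw, hs]; linarith
  have hswt : w ^ 2 + t ^ 2 = 2 * s := by rw [hs, hw]; ring
  have hw1 : 3.414 < w := by linarith
  have hw2 : w < 3.415 := by linarith
  have hs1 : 6.8 < s := by linarith
  have hsw1 : 3.414 * s < s * w := by nlinarith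
  have hsw2 : s * w < 3.415 * s := by nlinarith
  have hZ1 : Z < 5 := by
    have : (Z : ℚ) < 5 := by
      by_contra! hc
      linarith [mul_le_mul_of_nonneg_left hc (by linarith : 0 ≤ s)]
    exact_mod_cast this
  have hZ2 : -5 < Z := by
    have : -5 < (Z : ℚ) := by
      by_contra! hc
      linarith [mul_le_mul_of_nonneg_left hc (by linarith : 0 ≤ s)]
    exact_mod_cast this
  have hZmod : Z % 2 = 1 := by omega
  have hZ3 : (Z : ℚ) ≤ 3 := by exact_mod_cast (by omega : Z ≤ 3)
  have hZ4 : -3 ≤ (Z : ℚ) := by exact_mod_cast (by omega : -3 ≤ Z)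
  have hsZ1 := mul_le_mul_of_nonneg_left hZ3 (by linarith : 0 ≤ s)
  have hsZ2 := mul_le_mul_of_nonneg_left hZ4 (by linarith : 0 ≤ s)
  have hwpos : 0 < w := by linarith
  have htpos : 0 < t := by linarith
  have hswpos : 0 < s * w := by linarith
  have hwt : w + t < 4.83 := by linarith
  have hswwt : s * w * (w + t) < s * w * 4.83 := mul_lt_mul_of_pos_left hwt hswpos
  have hwt' : w - t = 2 := by linarith
  have comb (A : ℚ) : s * w * (2 * A) = w ^ 2 * w * A + t ^ 2 * w * A := by
    linear_combination -(w * A) * hswt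
  have hsZ : s * Z * (w - t) = s * Z * 2 := by rw [hwt']
  have hX1 : X < 5 := by
    have : (X : ℚ) < 5 := by
      by_contra! hc
      linarith [mul_lt_mul_of_pos_left h1 hwpos, mul_lt_mul_of_pos_left h2 htpos,
        comb X, mul_le_mul_of_nonneg_left hc hswpos.le]
    exact_mod_cast this
  have hX2 : -5 < X := by
    have : -5 < (X : ℚ) := by
      by_contra! hc
      linarith [mul_lt_mul_of_pos_left h3 hwpos,
        mul_lt_mul_of_pos_left (h0.trans hslack) htpos,
        comb X, mul_le_mul_of_nonneg_left hc hswpos.le]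
    exact_mod_cast this
  have hY1 : Y < 5 := by
    have : (Y : ℚ) < 5 := by
      by_contra! hc
      linarith [mul_lt_mul_of_pos_left h1 htpos,
        mul_lt_mul_of_pos_left (h0.trans hslack) hwpos,
        comb Y, mul_le_mul_of_nonneg_left hc hswpos.le]
    exact_mod_cast this
  have hY2 : -5 < Y := by
    have : -5 < (Y : ℚ) := by
      by_contra! hc
      linarith [mul_lt_mul_of_pos_left h3 htpos, mul_lt_mul_of_pos_left h2 hwpos,
        comb Y, mul_le_mul_of_nonneg_left hc hswpos.le]
    exact_mod_cast this
  clear comb hswwt hsZ hsZ1 hsZ2 hZ3 hZ4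
  subst hw hs
  obtain rfl | rfl | rfl | rfl : Z = -3 ∨ Z = -1 ∨ Z = 1 ∨ Z = 3 := by omega
  all_goals
    obtain rfl | rfl | rfl | rfl : X = -3 ∨ X = -1 ∨ X = 1 ∨ X = 3 := by omega
    all_goals
      obtain rfl | rfl | rfl | rfl : Y = -3 ∨ Y = -1 ∨ Y = 1 ∨ Y = 3 := by omega
      all_goals first | (exfalso; omega) | (push_cast at h0 h1 h2 h3; linarith)

theorem tetraVerts_hollow {t q : ℚ} (ht1 : 1.414 < t) (ht2 : t ^ 2 < 2) (hq1 : 1 ≤ q)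
    (hq : 4 * (t ^ 2 + 2 * t + 2) * (2 + t) * q =
      t * (2 + t) + (2 + t) ^ 2 + (t ^ 2 + 2 * t + 2) + 3 * (t ^ 2 + 2 * t + 2) * (2 + t))
    (u : Fin 3 → ℤ) :
    (∃ a : Fin 3 → ℚ, a ≠ 0 ∧ (∀ k, ∑ i, a i * tetraVerts t q k i ≤ 0) ∧ 0 ≤ ∑ i, a i * u i) ∨
    ∃ b : Fin 3 → ℚ, ∃ c : ℚ, 0 < c ∧ (∀ k, ∑ i, b i * tetraVerts t q k i ≤ c) ∧
      c ≤ ∑ i, b i * u i := by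
  obtain ⟨w, hw⟩ : ∃ w, w = 2 + t := ⟨_, rfl⟩
  obtain ⟨s, hs⟩ : ∃ s, s = t ^ 2 + 2 * t + 2 := ⟨_, rfl⟩
  have hswt : 2 * s = w ^ 2 + t ^ 2 := by rw [hs, hw]; ring
  rw [← hw, ← hs] at hq
  have hwpos : 0 < w := by linarith
  have hspos : 0 < s := by nlinarith
  have hcube : w ^ 3 = 2 * (s * w) - t ^ 2 * w := by rw [← mul_assoc, hswt]; ring
  have hqcube : q * w ^ 3 = 2 * (q * (s * w)) - q * (t ^ 2 * w) := by rw [hcube]; ring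
  have hsw : 0 < s * w := mul_pos hspos hwpos
  have htw : 0 < t * w := mul_pos (by linarith) hwpos
  have hqsw : 0 < q * (s * w) := mul_pos (by linarith) hsw
  have hsum (α β γ : ℚ) (k : Fin 4) :
      ∑ i, ![β + γ, α + γ, α + β] i * tetraVerts t q k i =
        (α * tetraShift t q k 0 + β * tetraShift t q k 1 + γ * tetraShift t q k 2) / 2 := by
    simp only [Fin.sum_univ_three, tetraVerts, Matrix.cons_val]
    ring
  have hsumu (α β γ : ℚ) : ∑ i, ![β + γ, α + γ, α + β] i * (u i : ℚ) =
      (α * (-1 + 2 * (u 1 + u 2)) + β * (1 + 2 * (u 0 + u 2)) + γ * (1 + 2 * (u 0 + u 1))) / 2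
        - (-α + β + γ) / 2 := by
    simp only [Fin.sum_univ_three, Matrix.cons_val]
    ring
  obtain ⟨X, hX⟩ : ∃ X : ℤ, X = -1 + 2 * (u 1 + u 2) := ⟨_, rfl⟩
  obtain ⟨Y, hY⟩ : ∃ Y : ℤ, Y = 1 + 2 * (u 0 + u 2) := ⟨_, rfl⟩
  obtain ⟨Z, hZ⟩ : ∃ Z : ℤ, Z = 1 + 2 * (u 0 + u 1) := ⟨_, rfl⟩
  have hXq : (X : ℚ) = -1 + 2 * (u 1 + u 2) := by exact_mod_cast hX
  have hYq : (Y : ℚ) = 1 + 2 * (u 0 + u 2) := by exact_mod_cast hY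
  have hZq : (Z : ℚ) = 1 + 2 * (u 0 + u 1) := by exact_mod_cast hZ
  simp only [← hXq, ← hYq, ← hZq] at hsumu
  by_cases h0 : t * w + w ^ 2 + s ≤ -(t * w) * X + w ^ 2 * Y + s * Z
  · refine .inl ⟨![w ^ 2 + s, -(t * w) + s, -(t * w) + w ^ 2], ?_, ?_, ?_⟩
    · intro h
      have := congrFun h 0
      simp only [Matrix.cons_val, Pi.zero_apply] at this
      nlinarith
    · intro k
      rw [hsum]
      fin_cases k <;> simp only [tetraShift, tetraXYZ, Matrix.cons_val, Fin.reduceFinMk,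
        Fin.zero_eta, Fin.mk_one, Fin.isValue, ← hw] <;>
        linarith
    · rw [hsumu]
      linarith
  by_cases h1 : s * w ≤ t * w * Y + w ^ 2 * X - s * Z
  · refine .inr ⟨![t * w + -s, w ^ 2 + -s, w ^ 2 + t * w],
      (s * w - (-w ^ 2 + t * w + -s)) / 2, ?_, ?_, ?_⟩
    · nlinarith
    · intro k
      rw [hsum]
      fin_cases k <;> simp only [tetraShift, tetraXYZ, Matrix.cons_val, Fin.reduceFinMk,
        Fin.zero_eta, Fin.mk_one, Fin.isValue, ← hw] <;>
        linarith
    · rw [hsumu]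
      linarith
  by_cases h2 : s * w ≤ t * w * X - w ^ 2 * Y + s * Z
  · refine .inr ⟨![-w ^ 2 + s, t * w + s, t * w + -w ^ 2],
      (s * w - (-(t * w) + -w ^ 2 + s)) / 2, ?_, ?_, ?_⟩
    · nlinarith
    · intro k
      rw [hsum]
      fin_cases k <;> simp only [tetraShift, tetraXYZ, Matrix.cons_val, Fin.reduceFinMk,
        Fin.zero_eta, Fin.mk_one, Fin.isValue, ← hw] <;>
        linarith
    · rw [hsumu]
      linarith
  by_cases h3 : s * w ≤ -(t * w) * Y - w ^ 2 * X - s * Z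
  · refine .inr ⟨![-(t * w) + -s, -w ^ 2 + -s, -w ^ 2 + -(t * w)],
      (s * w - (-(-w ^ 2) + -(t * w) + -s)) / 2, ?_, ?_, ?_⟩
    · nlinarith
    · intro k
      rw [hsum]
      fin_cases k <;> simp only [tetraShift, tetraXYZ, Matrix.cons_val, Fin.reduceFinMk,
        Fin.zero_eta, Fin.mk_one, Fin.isValue, ← hw] <;>
        linarith
    · rw [hsumu]
      linarith
  exfalso
  push Not at h0 h1 h2 h3
  exact tetraXYZ_not_interior ht1 ht2 hw hs (by omega) (by omega) (by omega) h0 h1 h2 h3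

theorem ofReal_two_add_div_three_le_iSup_wp_div {t : ℚ} (ht1 : 1.414 < t) (ht2 : t ^ 2 < 2) :
    ENNReal.ofReal ((2 + t) / 3) ≤ ⨆ (d : ℕ) (_ : 0 < d), wp d / (d : ℝ≥0∞) := by
  have hs : 0 < 4 * (t ^ 2 + 2 * t + 2) * (2 + t) := by nlinarith
  obtain ⟨q, hq⟩ : ∃ q, 4 * (t ^ 2 + 2 * t + 2) * (2 + t) * q =
      t * (2 + t) + (2 + t) ^ 2 + (t ^ 2 + 2 * t + 2) + 3 * (t ^ 2 + 2 * t + 2) * (2 + t) :=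
    ⟨_, mul_div_cancel₀ _ hs.ne'⟩
  have hq1 : 1 ≤ q := by
    by_contra! h
    nlinarith
  let m : ℕ := ∏ k, ∏ i, (tetraVerts t q k i).den
  have hm : 0 < m := Finset.prod_pos fun k _ => Finset.prod_pos fun i _ => Rat.den_pos _
  have hint : ∀ k i, ∃ z : ℤ, (m : ℚ) * tetraVerts t q k i = z := by
    intro k i
    obtain ⟨c, hc⟩ : (tetraVerts t q k i).den ∣ m :=
      (Finset.dvd_prod_of_mem _ (Finset.mem_univ i)).trans
        (Finset.dvd_prod_of_mem (fun k => ∏ i, (tetraVerts t q k i).den) (Finset.mem_univ k))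
    refine ⟨c * (tetraVerts t q k i).num, ?_⟩
    rw [hc]
    push_cast
    rw [mul_right_comm, Rat.den_mul_eq_num]
    ring
  have hw := ofReal_mul_le_wp hm (by norm_num : 0 < 3) hint (tetraVerts_span (by linarith) hq1)
    (tetraVerts_hollow ht1 ht2 hq1 hq) (tetraVerts_width (by linarith) hq1)
  refine le_trans ?_ (le_iSup₂ (f := fun (d : ℕ) (_ : 0 < d) => wp d / (d : ℝ≥0∞)) (m * 3)
    (by positivity))
  rw [ENNReal.le_div_iff_mul_le (by left; positivity) (by left; exact ENNReal.natCast_ne_top _)]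
  refine le_trans (le_of_eq ?_) hw
  rw [← ENNReal.ofReal_natCast, ← ENNReal.ofReal_mul' (Nat.cast_nonneg _)]
  congr 1
  push_cast
  ring

theorem sup_wp_div_and_sup_ws_div_lower_bounds :
    ENNReal.ofReal ((2 + Real.sqrt 2) / 3) ≤
      (⨆ (d : ℕ) (_ : 0 < d), wp d / (d : ℝ≥0∞)) ∧
    (102 : ℝ≥0∞) / 101 ≤ (⨆ (d : ℕ) (_ : 0 < d), ws d / (d : ℝ≥0∞)) := by
  constructor
  · rcases eq_or_ne (⨆ (d : ℕ) (_ : 0 < d), wp d / (d : ℝ≥0∞)) ⊤ with htop | htop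
    · simp [htop]
    rw [ENNReal.ofReal_le_iff_le_toReal htop]
    by_contra! h
    have hsqrt : (1.414 : ℝ) < Real.sqrt 2 := Real.lt_sqrt_of_sq_lt (by norm_num)
    obtain ⟨t, ht1, ht2⟩ := exists_rat_btwn (max_lt hsqrt (by linarith :
      3 * (⨆ (d : ℕ) (_ : 0 < d), wp d / (d : ℝ≥0∞)).toReal - 2 < Real.sqrt 2))
    obtain ⟨ht3, ht4⟩ := max_lt_iff.1 ht1
    have ht5 : (1.414 : ℚ) < t := by
      rw [← Rat.cast_lt (K := ℝ)]
      norm_num at ht3 ⊢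
      exact ht3
    have ht6 : t ^ 2 < 2 := by
      have : (t : ℝ) ^ 2 < 2 := (Real.lt_sqrt (by linarith)).1 ht2
      exact_mod_cast this
    have := (ENNReal.ofReal_le_iff_le_toReal htop).1 (ofReal_two_add_div_three_le_iSup_wp_div ht5 ht6)
    linarith
  · refine le_trans ?_ (le_iSup₂ (f := fun (d : ℕ) (_ : 0 < d) => ws d / (d : ℝ≥0∞)) 404
      (by norm_num))
    refine le_trans ?_ (ENNReal.div_le_div_right le_ws_404 _)
    rw [← ENNReal.mul_div_mul_right 102 101 (c := 4) (by norm_num) (by norm_num)]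
    norm_num
end

section
/- For every positive integer d one has w_c(d+1) ≥ w_c(d) + 1, w_c(d+2) ≥ w_c(d) + 1 + 2/√3, and w_c(d+3) ≥ w_c(d) + 2 + √2; consequently, for every integer d ≥ 2 one has w_c(d) ≥ (1/2 + 1/√3)·d (all inequalities in [0,∞]). -/
open Set ENNReal

/-- `ℝ^ι` contains a hollow convex body of lattice width at least `w`. -/
def HasHollowBody (ι : Type*) [Fintype ι] (w : ℝ) : Prop :=
  ∃ K : Set (ι → ℝ), IsCompact K ∧ Convex ℝ K ∧ (interior K).Nonempty ∧
    (∀ z : ι → ℤ, (fun i => (z i : ℝ)) ∉ interior K) ∧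
    ∀ f : (ι → ℝ) →ₗ[ℝ] ℝ, (∀ v : ι → ℤ, ∃ k : ℤ, f (fun i => (v i : ℝ)) = (k : ℝ)) →
      f ≠ 0 → ∃ x ∈ K, ∃ y ∈ K, w ≤ f x - f y

lemma HasHollowBody.mono {ι : Type*} [Fintype ι] {w w' : ℝ} (h : HasHollowBody ι w)
    (hw : w' ≤ w) : HasHollowBody ι w' := by
  obtain ⟨K, h1, h2, h3, h4, h5⟩ := h
  refine ⟨K, h1, h2, h3, h4, fun f hf hf0 => ?_⟩
  obtain ⟨x, hx, y, hy, hxy⟩ := h5 f hf hf0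
  exact ⟨x, hx, y, hy, hw.trans hxy⟩

lemma HasHollowBody.ofReal_le_wc {n : ℕ} {w : ℝ} (hn : 0 < n) (h : HasHollowBody (Fin n) w) :
    ENNReal.ofReal w ≤ wc n := by
  obtain ⟨K, h1, h2, h3, h4, h5⟩ := h
  have hle : w ≤ latticeWidth K := by
    refine le_csInf ?_ ?_
    · refine ⟨_, LinearMap.proj ⟨0, hn⟩, fun v => ⟨v ⟨0, hn⟩, rfl⟩, fun h0 => ?_, rfl⟩
      simpa using LinearMap.congr_fun h0 (fun _ => 1)
    · rintro _ ⟨f, hf, hf0, rfl⟩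
      obtain ⟨x, hx, y, hy, hxy⟩ := h5 f hf hf0
      have hc : IsCompact (f '' K) := h1.image f.continuous_of_finiteDimensional
      have := le_csSup hc.bddAbove (mem_image_of_mem f hx)
      have := csInf_le hc.bddBelow (mem_image_of_mem f hy)
      linarith
  refine (ENNReal.ofReal_le_ofReal hle).trans ?_
  exact le_iSup_of_le K <| le_iSup_of_le h1 <| le_iSup_of_le h2 <| le_iSup_of_le h3 <|
    le_iSup_of_le h4 le_rfl

lemma hasHollowBody_latticeWidth {ι : Type*} [Fintype ι] {K : Set (ι → ℝ)} (h1 : IsCompact K)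
    (h2 : Convex ℝ K) (h3 : (interior K).Nonempty)
    (h4 : ∀ z : ι → ℤ, (fun i => (z i : ℝ)) ∉ interior K) :
    HasHollowBody ι (latticeWidth K) := by
  refine ⟨K, h1, h2, h3, h4, fun f hf hf0 => ?_⟩
  have hK : K.Nonempty := h3.mono interior_subset
  have hcomp (g : (ι → ℝ) →ₗ[ℝ] ℝ) : IsCompact (g '' K) :=
    h1.image g.continuous_of_finiteDimensional
  obtain ⟨x, hx, hx'⟩ := (hcomp f).sSup_mem (hK.image f)
  obtain ⟨y, hy, hy'⟩ := (hcomp f).sInf_mem (hK.image f)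
  refine ⟨x, hx, y, hy, ?_⟩
  rw [hx', hy']
  refine csInf_le ⟨0, ?_⟩ ⟨f, hf, hf0, rfl⟩
  rintro _ ⟨g, -, -, rfl⟩
  exact sub_nonneg.2 (Real.sInf_le_sSup _ (hcomp g).bddBelow (hcomp g).bddAbove)

lemma exists_add_smul_mem_of_mem_interior {E : Type*} [AddCommGroup E] [Module ℝ E]
    [TopologicalSpace E] [ContinuousAdd E] [ContinuousSMul ℝ E] {K : Set E} {z : E}
    (hz : z ∈ interior K) (u : E) : ∃ ε : ℝ, 0 < ε ∧ z + ε • u ∈ K := by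
  have hcont : Continuous fun ε : ℝ => z + ε • u := by fun_prop
  have hnhds : ∀ᶠ ε : ℝ in nhds 0, z + ε • u ∈ K := by
    apply hcont.continuousAt.eventually_mem
    simpa using mem_interior_iff_mem_nhds.1 hz
  obtain ⟨ε, h, hε⟩ :=
    ((hnhds.filter_mono nhdsWithin_le_nhds).and (self_mem_nhdsWithin (s := Ioi (0 : ℝ)))).exists
  exact ⟨ε, hε, h⟩

lemma IsCompact.convexJoin {E : Type*} [AddCommGroup E] [Module ℝ E] [TopologicalSpace E]
    [ContinuousAdd E] [ContinuousSMul ℝ E] {s t : Set E} (hs : IsCompact s) (ht : IsCompact t) :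
    IsCompact (convexJoin ℝ s t) := by
  have hcont : Continuous fun q : ℝ × E × E => (1 - q.1) • q.2.1 + q.1 • q.2.2 := by fun_prop
  convert ((isCompact_Icc (a := (0 : ℝ)) (b := 1)).prod (hs.prod ht)).image hcont using 1
  ext p
  simp only [mem_convexJoin, segment_eq_image, mem_image, Prod.exists, mem_prod]
  constructor
  · rintro ⟨x, hx, y, hy, θ, hθ, rfl⟩
    exact ⟨θ, x, y, ⟨hθ, hx, hy⟩, rfl⟩
  · rintro ⟨θ, x, y, ⟨hθ, hx, hy⟩, rfl⟩
    exact ⟨x, hx, y, hy, θ, hθ, rfl⟩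

/-- The free sum of hollow bodies about interior points, suitably dilated, is hollow, and lattice
width is additive under this operation. -/
lemma HasHollowBody.add {m n : ℕ} {w₁ w₂ : ℝ} (hw₁ : 0 < w₁) (hw₂ : 0 < w₂)
    (h₁ : HasHollowBody (Fin m) w₁) (h₂ : HasHollowBody (Fin n) w₂) :
    HasHollowBody (Fin (m + n)) (w₁ + w₂) := by
  obtain ⟨K₁, comp₁, conv₁, ⟨c₁, hc₁⟩, hol₁, wid₁⟩ := h₁
  obtain ⟨K₂, comp₂, conv₂, ⟨c₂, hc₂⟩, hol₂, wid₂⟩ := h₂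
  have hc₁' := interior_subset hc₁
  have hc₂' := interior_subset hc₂
  set W := w₁ + w₂ with hW
  have hWpos : 0 < W := by positivity
  let J : ((Fin m → ℝ) × (Fin n → ℝ)) →ₗ[ℝ] (Fin (m + n) → ℝ) :=
    { toFun := fun p => Fin.append p.1 p.2
      map_add' := fun p q => by
        ext i
        refine Fin.addCases (fun i => ?_) (fun i => ?_) i <;> simp
      map_smul' := fun a p => by
        ext i
        refine Fin.addCases (fun i => ?_) (fun i => ?_) i <;> simp }
  have hJ (p) : J p = Fin.append p.1 p.2 := rfl
  have hJc : Continuous J := J.continuous_of_finiteDimensional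
  let A : (Fin m → ℝ) → (Fin (m + n) → ℝ) := fun x => J (c₁ + (W / w₁) • (x - c₁), c₂)
  let B : (Fin n → ℝ) → (Fin (m + n) → ℝ) := fun y => J (c₁, c₂ + (W / w₂) • (y - c₂))
  have hA : Continuous A := by fun_prop
  have hB : Continuous B := by fun_prop
  let K := convexHull ℝ (A '' K₁ ∪ B '' K₂)
  have hAK {x} (hx : x ∈ K₁) : A x ∈ K := subset_convexHull ℝ _ (.inl (mem_image_of_mem A hx))
  have hBK {y} (hy : y ∈ K₂) : B y ∈ K := subset_convexHull ℝ _ (.inr (mem_image_of_mem B hy))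
  have hK : Convex ℝ K := convex_convexHull ℝ _
  have convA : Convex ℝ (A '' K₁) := by
    rintro _ ⟨x, hx, rfl⟩ _ ⟨y, hy, rfl⟩ a b ha hb hab
    refine ⟨a • x + b • y, conv₁ hx hy ha hb hab, ?_⟩
    simp only [A, ← map_smul, ← map_add]
    congr 1
    obtain rfl : b = 1 - a := by linarith
    ext i <;> simp <;> ring
  have convB : Convex ℝ (B '' K₂) := by
    rintro _ ⟨x, hx, rfl⟩ _ ⟨y, hy, rfl⟩ a b ha hb hab
    refine ⟨a • x + b • y, conv₂ hx hy ha hb hab, ?_⟩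
    simp only [B, ← map_smul, ← map_add]
    congr 1
    obtain rfl : b = 1 - a := by linarith
    ext i <;> simp <;> ring
  have hKjoin : K = convexJoin ℝ (A '' K₁) (B '' K₂) :=
    convA.convexHull_union convB ⟨_, mem_image_of_mem A hc₁'⟩ ⟨_, mem_image_of_mem B hc₂'⟩
  refine ⟨K, hKjoin ▸ (comp₁.image hA).convexJoin (comp₂.image hB), hK, ?_, ?_, ?_⟩
  · let g₁ : (Fin (m + n) → ℝ) → (Fin m → ℝ) :=
      fun p => c₁ + (2 * (w₁ / W)) • ((fun i => p (Fin.castAdd n i)) - c₁)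
    let g₂ : (Fin (m + n) → ℝ) → (Fin n → ℝ) :=
      fun p => c₂ + (2 * (w₂ / W)) • ((fun i => p (Fin.natAdd m i)) - c₂)
    have hg₁ : Continuous g₁ := by fun_prop
    have hg₂ : Continuous g₂ := by fun_prop
    refine ⟨J (c₁, c₂), mem_interior.2 ⟨g₁ ⁻¹' interior K₁ ∩ g₂ ⁻¹' interior K₂, ?_,
      (isOpen_interior.preimage hg₁).inter (isOpen_interior.preimage hg₂), ?_, ?_⟩⟩
    · rintro p ⟨hp₁, hp₂⟩
      have := hK (hAK (interior_subset hp₁)) (hBK (interior_subset hp₂))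
        (by norm_num : (0 : ℝ) ≤ 1 / 2) (by norm_num : (0 : ℝ) ≤ 1 / 2) (by norm_num)
      convert this using 1
      ext i
      refine Fin.addCases (fun i => ?_) (fun i => ?_) i <;>
        simp [A, B, hJ, g₁, g₂] <;> field_simp <;> ring
    · simpa [g₁, hJ, Fin.append_left] using hc₁
    · simpa [g₂, hJ, Fin.append_right] using hc₂
  · intro z hz
    obtain ⟨ε, hε, hmem⟩ :=
      exists_add_smul_mem_of_mem_interior hz ((fun i => (z i : ℝ)) - J (c₁, c₂))
    rw [hKjoin, mem_convexJoin] at hmem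
    obtain ⟨_, ⟨x, hx, rfl⟩, _, ⟨y, hy, rfl⟩, a, b, ha, hb, hab, hp⟩ := hmem
    have ha' : w₁ / W * (1 + ε) ≤ a := by
      by_contra! hlt
      apply hol₁ (fun i => z (Fin.castAdd n i))
      have hθ : a * W / (w₁ * (1 + ε)) < 1 := by
        rw [div_lt_one (by positivity)]
        calc a * W < w₁ / W * (1 + ε) * W := by gcongr
          _ = _ := by field_simp
      have := conv₁.combo_interior_self_mem_interior hc₁ hx (sub_pos.2 hθ)
        (by positivity : 0 ≤ a * W / (w₁ * (1 + ε))) (by ring)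
      convert this using 1
      ext i
      have := congrFun hp (Fin.castAdd n i)
      simp [A, B, hJ] at this ⊢
      obtain rfl : b = 1 - a := by linarith
      field_simp
      field_simp at this
      linear_combination -this
    have hb' : w₂ / W * (1 + ε) ≤ b := by
      by_contra! hlt
      apply hol₂ (fun i => z (Fin.natAdd m i))
      have hθ : b * W / (w₂ * (1 + ε)) < 1 := by
        rw [div_lt_one (by positivity)]
        calc b * W < w₂ / W * (1 + ε) * W := by gcongr
          _ = _ := by field_simp
      have := conv₂.combo_interior_self_mem_interior hc₂ hy (sub_pos.2 hθ)
        (by positivity : 0 ≤ b * W / (w₂ * (1 + ε))) (by ring)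
      convert this using 1
      ext i
      have := congrFun hp (Fin.natAdd m i)
      simp [A, B, hJ] at this ⊢
      obtain rfl : a = 1 - b := by linarith
      field_simp
      field_simp at this
      linear_combination -this
    have : w₁ / W * (1 + ε) + w₂ / W * (1 + ε) = 1 + ε := by field_simp; simp [hW]
    linarith
  · intro f hf hf0
    let f₁ := f ∘ₗ J ∘ₗ LinearMap.inl ℝ _ _
    let f₂ := f ∘ₗ J ∘ₗ LinearMap.inr ℝ _ _
    have hsplit (x y) : f (J (x, y)) = f₁ x + f₂ y := by
      simp [f₁, f₂, ← map_add]
    by_cases h₁ : f₁ = 0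
    · have h₂ : f₂ ≠ 0 := by
        rintro h₂
        apply hf0
        ext p
        have hp : (Pi.single p 1 : Fin (m + n) → ℝ) =
            J (fun i => (Pi.single p 1 : Fin (m + n) → ℝ) (Fin.castAdd n i),
              fun i => (Pi.single p 1 : Fin (m + n) → ℝ) (Fin.natAdd m i)) := by
          ext i
          refine Fin.addCases (fun i => ?_) (fun i => ?_) i <;> simp [hJ]
        have : f (Pi.single p 1) = 0 := by
          rw [hp, hsplit, h₁, h₂]
          simp
        simpa using this
      obtain ⟨x, hx, y, hy, hxy⟩ := wid₂ f₂ (fun v => by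
        obtain ⟨k, hk⟩ := hf (Fin.append 0 v)
        refine ⟨k, hk ▸ congrArg f ?_⟩
        ext i
        refine Fin.addCases (fun i => ?_) (fun i => ?_) i <;> simp [hJ]) h₂
      refine ⟨B x, hBK hx, B y, hBK hy, ?_⟩
      have : f (B x) - f (B y) = W / w₂ * (f₂ x - f₂ y) := by
        simp only [B, hsplit, map_add, map_smul, map_sub, smul_eq_mul]
        ring
      rw [this, div_mul_eq_mul_div, le_div_iff₀ hw₂]
      gcongr
    · obtain ⟨x, hx, y, hy, hxy⟩ := wid₁ f₁ (fun v => by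
        obtain ⟨k, hk⟩ := hf (Fin.append v 0)
        refine ⟨k, hk ▸ congrArg f ?_⟩
        ext i
        refine Fin.addCases (fun i => ?_) (fun i => ?_) i <;> simp [hJ]) h₁
      refine ⟨A x, hAK hx, A y, hAK hy, ?_⟩
      have : f (A x) - f (A y) = W / w₁ * (f₁ x - f₁ y) := by
        simp only [A, hsplit, map_add, map_smul, map_sub, smul_eq_mul]
        ring
      rw [this, div_mul_eq_mul_div, le_div_iff₀ hw₁]
      gcongr

lemma hasHollowBody_of_polytope {ι κ : Type*} [Fintype ι] [DecidableEq ι] [Finite κ]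
    (A : κ → ι → ℝ) (c : κ → ℝ) {w M : ℝ} (hA : ∀ j, A j ≠ 0)
    (hM : ∀ p : ι → ℝ, (∀ j, 0 ≤ c j + ∑ i, A j i * p i) → ∀ i, |p i| ≤ M)
    (hp : ∃ p : ι → ℝ, ∀ j, 0 < c j + ∑ i, A j i * p i)
    (hz : ∀ z : ι → ℤ, ¬ ∀ j, 0 < c j + ∑ i, A j i * (z i : ℝ))
    (hw : ∀ F : ι → ℤ, F ≠ 0 → ∃ x : ι → ℝ, (∀ j, 0 ≤ c j + ∑ i, A j i * x i) ∧
      ∃ y : ι → ℝ, (∀ j, 0 ≤ c j + ∑ i, A j i * y i) ∧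
        w ≤ ∑ i, (F i : ℝ) * x i - ∑ i, (F i : ℝ) * y i) :
    HasHollowBody ι w := by
  refine ⟨{p | ∀ j, 0 ≤ c j + ∑ i, A j i * p i}, ?_, ?_, ?_, ?_, ?_⟩
  · refine (isCompact_Icc (a := fun _ : ι => -M) (b := fun _ => M)).of_isClosed_subset ?_ ?_
    · simp only [ofPred_forall]
      exact isClosed_iInter fun j => isClosed_le (by fun_prop) (by fun_prop)
    · exact fun p hp => ⟨fun i => (abs_le.1 (hM p hp i)).1, fun i => (abs_le.1 (hM p hp i)).2⟩
  · intro x hx y hy a b ha hb hab j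
    have : c j + ∑ i, A j i * (a • x + b • y) i =
        a * (c j + ∑ i, A j i * x i) + b * (c j + ∑ i, A j i * y i) := by
      simp only [Pi.add_apply, Pi.smul_apply, smul_eq_mul, mul_add, Finset.sum_add_distrib,
        Finset.mul_sum, mul_left_comm a, mul_left_comm b]
      linear_combination -(c j) * hab
    rw [this]
    have := hx j
    have := hy j
    positivity
  · obtain ⟨p, hp⟩ := hp
    refine ⟨p, mem_interior.2 ⟨{p | ∀ j, 0 < c j + ∑ i, A j i * p i}, fun q hq j => (hq j).le,
      ?_, hp⟩⟩
    simp only [ofPred_forall]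
    exact isOpen_iInter_of_finite fun j => isOpen_lt (by fun_prop) (by fun_prop)
  · intro z hzK
    refine hz z fun j => ?_
    obtain ⟨ε, hε, hmem⟩ := exists_add_smul_mem_of_mem_interior hzK (-A j)
    have hj := hmem j
    have hpos : 0 < ∑ i, A j i * A j i := by
      obtain ⟨i, hi⟩ := Function.ne_iff.1 (hA j)
      exact Finset.sum_pos' (fun i _ => mul_self_nonneg _)
        ⟨i, Finset.mem_univ i, mul_self_pos.2 hi⟩
    have : c j + ∑ i, A j i * ((fun i => (z i : ℝ)) + ε • -A j) i =
        c j + ∑ i, A j i * (z i : ℝ) - ε * ∑ i, A j i * A j i := by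
      simp only [Pi.add_apply, Pi.smul_apply, Pi.neg_apply, smul_eq_mul, mul_add,
        Finset.sum_add_distrib, Finset.mul_sum, mul_neg, Finset.sum_neg_distrib,
        mul_left_comm ε]
      ring
    rw [this] at hj
    have := mul_pos hε hpos
    linarith
  · intro f hf hf0
    choose F hF using fun i => hf (Pi.single i 1)
    have hfF (p : ι → ℝ) : f p = ∑ i, (F i : ℝ) * p i := by
      conv_lhs => rw [pi_eq_sum_univ' p]
      rw [map_sum]
      refine Finset.sum_congr rfl fun i _ => ?_
      rw [map_smul, smul_eq_mul, mul_comm, ← hF i]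
      congr 2
      ext j
      by_cases h : j = i
      · subst h; simp
      · simp [h]
    obtain ⟨x, hx, y, hy, hxy⟩ := hw F (by
      rintro rfl
      exact hf0 (LinearMap.ext fun p => by simp [hfF p]))
    exact ⟨x, hx, y, hy, by rwa [hfF, hfF]⟩

lemma hasHollowBody_one : HasHollowBody (Fin 1) 1 := by
  refine hasHollowBody_of_polytope (κ := Fin 2) (M := 1) ![![1], ![-1]] ![0, 1] ?_ ?_ ?_ ?_ ?_
  · simp [Fin.forall_fin_succ]
  · intro p hp
    simp [Fin.forall_fin_succ] at hp ⊢
    exact abs_le.2 ⟨by linarith, by linarith⟩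
  · exact ⟨![1 / 2], by simp [Fin.forall_fin_succ]; norm_num⟩
  · intro z hz
    simp [Fin.forall_fin_succ] at hz
    norm_cast at hz
    lia
  · intro F hF
    have hF0 : F 0 ≠ 0 := fun h => hF (by ext i; fin_cases i; simpa using h)
    rcases lt_or_gt_of_ne hF0 with h | h
    · refine ⟨![0], by simp [Fin.forall_fin_succ], ![1], by simp [Fin.forall_fin_succ], ?_⟩
      have : (F 0 : ℝ) ≤ -1 := by exact_mod_cast (by lia : F 0 ≤ -1)
      simp
      linarith
    · refine ⟨![1], by simp [Fin.forall_fin_succ], ![0], by simp [Fin.forall_fin_succ], ?_⟩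
      have : (1 : ℝ) ≤ F 0 := by exact_mod_cast h
      simp
      linarith

/-- Hurkens' triangle. -/
lemma hasHollowBody_two : HasHollowBody (Fin 2) (1 + 2 / √3) := by
  set q := √3 with hq
  have hqq : q * q = 3 := Real.mul_self_sqrt (by norm_num)
  have hq0 : 0 < q := Real.sqrt_pos.2 (by norm_num)
  have hq1 : 1.73 < q := by nlinarith
  have hq2 : q < 1.74 := by nlinarith
  have hbound (x y : ℝ) (h₀ : 0 ≤ 1 - x + (q - 2) * y) (h₁ : 0 ≤ q - 1 + (2 - q) * x + (1 - q) * y)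
      (h₂ : 0 ≤ (q - 1) * x + y) : (-1 ≤ x ∧ x ≤ 3 / 2) ∧ (-1 ≤ y ∧ y ≤ 3 / 2) := by
    set L₀ := 1 - x + (q - 2) * y with hL₀
    set L₁ := q - 1 + (2 - q) * x + (1 - q) * y with hL₁
    set L₂ := (q - 1) * x + y with hL₂
    have hsum : L₀ + L₁ + L₂ = q := by rw [hL₀, hL₁, hL₂]; ring
    have hx : 3 * q * x = (2 + q) * L₁ + 2 * L₂ - (1 + q) * L₀ := by
      rw [hL₀, hL₁, hL₂]; linear_combination (x + 2 * y - 1) * hqq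
    have hy : 3 * q * y = (2 + q) * L₂ + 2 * L₀ - (1 + q) * L₁ := by
      rw [hL₀, hL₁, hL₂]; linear_combination (1 - 2 * x - y) * hqq
    refine ⟨⟨?_, ?_⟩, ?_, ?_⟩ <;> refine le_of_mul_le_mul_left ?_ (by positivity : 0 < 3 * q) <;>
      nlinarith [mul_nonneg hq0.le h₀, mul_nonneg hq0.le h₁, mul_nonneg hq0.le h₂]
  have htarget : 1 + 2 / q = (3 + 2 * q) / 3 := by
    field_simp
    linear_combination -2 * hqq
  rw [htarget]
  let V₀ : Fin 2 → ℝ := ![(2 + q) / 3, -(1 + q) / 3]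
  let V₁ : Fin 2 → ℝ := ![2 / 3, (2 + q) / 3]
  let V₂ : Fin 2 → ℝ := ![-(1 + q) / 3, 2 / 3]
  let A : Fin 3 → Fin 2 → ℝ := ![![-1, q - 2], ![2 - q, 1 - q], ![q - 1, 1]]
  let c : Fin 3 → ℝ := ![1, q - 1, 0]
  have hV₀ (j) : 0 ≤ c j + ∑ i, A j i * V₀ i := by
    fin_cases j <;> simp [A, c, V₀, Fin.sum_univ_succ] <;> nlinarith
  have hV₁ (j) : 0 ≤ c j + ∑ i, A j i * V₁ i := by
    fin_cases j <;> simp [A, c, V₁, Fin.sum_univ_succ] <;> nlinarith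
  have hV₂ (j) : 0 ≤ c j + ∑ i, A j i * V₂ i := by
    fin_cases j <;> simp [A, c, V₂, Fin.sum_univ_succ] <;> nlinarith
  refine hasHollowBody_of_polytope (M := 2) A c ?_ ?_ ?_ ?_ ?_
  · intro j h
    have := congrFun h 1
    fin_cases j <;> simp [A] at this <;> linarith
  · intro p hp
    simp [A, c, Fin.forall_fin_succ, Fin.sum_univ_succ] at hp ⊢
    obtain ⟨h₁, h₂⟩ := hbound (p 0) (p 1) (by linarith) (by linarith) (by linarith)
    exact ⟨abs_le.2 ⟨by linarith, by linarith⟩, abs_le.2 ⟨by linarith, by linarith⟩⟩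
  · exact ⟨![1 / 3, 1 / 3], by
      simp [A, c, Fin.forall_fin_succ, Fin.sum_univ_succ]
      refine ⟨?_, ?_, ?_⟩ <;> linarith⟩
  · intro z hz
    simp [A, c, Fin.forall_fin_succ, Fin.sum_univ_succ] at hz
    generalize z 0 = x at hz
    generalize z 1 = y at hz
    obtain ⟨⟨hx₁, hx₂⟩, hy₁, hy₂⟩ := hbound x y (by linarith) (by linarith) (by linarith)
    have hx₃ : -1 ≤ x := by exact_mod_cast hx₁
    have hx₄ : x < 2 := by exact_mod_cast (by linarith : (x : ℝ) < 2)
    have hy₃ : -1 ≤ y := by exact_mod_cast hy₁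
    have hy₄ : y < 2 := by exact_mod_cast (by linarith : (y : ℝ) < 2)
    clear hx₁ hx₂ hy₁ hy₂
    interval_cases x <;> interval_cases y <;> norm_num at hz <;> linarith
  · intro F hF
    have hF0 : F 0 ≠ 0 ∨ F 1 ≠ 0 := by
      by_contra! h
      exact hF (by ext i; fin_cases i <;> simp [h])
    have hcases : (1 ≤ F 0 ∧ F 1 ≤ 0) ∨ (F 0 ≤ -1 ∧ 0 ≤ F 1) ∨ (1 ≤ F 0 ∧ 1 ≤ F 1) ∨
        (F 0 ≤ -1 ∧ F 1 ≤ -1) ∨ (F 0 = 0 ∧ 1 ≤ F 1) ∨ (F 0 = 0 ∧ F 1 ≤ -1) := by lia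
    rcases hcases with ⟨hu, hv⟩ | ⟨hu, hv⟩ | ⟨hu, hv⟩ | ⟨hu, hv⟩ | ⟨hu, hv⟩ | ⟨hu, hv⟩ <;>
      [refine ⟨V₀, hV₀, V₂, hV₂, ?_⟩; refine ⟨V₂, hV₂, V₀, hV₀, ?_⟩;
        refine ⟨V₁, hV₁, V₂, hV₂, ?_⟩; refine ⟨V₂, hV₂, V₁, hV₁, ?_⟩;
        refine ⟨V₁, hV₁, V₀, hV₀, ?_⟩; refine ⟨V₀, hV₀, V₁, hV₁, ?_⟩] <;>
      rify at hu hv <;> simp [V₀, V₁, V₂, Fin.sum_univ_two] <;> nlinarith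

lemma exists_isMax_pred_lt {F : Fin 4 → ℤ} (h : ∃ i, F i ≠ F 3) :
    ∃ i, (∀ j, F j ≤ F i) ∧ F (i - 1) < F i := by
  by_contra! hc
  obtain ⟨i, hi⟩ := h
  obtain ⟨k, hk⟩ := Finite.exists_max F
  have h₁ := hc k hk
  have h₂ := hc (k - 1) fun j => (hk j).trans h₁
  have h₃ := hc (k - 1 - 1) fun j => (hk j).trans (h₁.trans h₂)
  have hall (j) : F j = F k := by
    refine le_antisymm (hk j) ?_
    have : j = k ∨ j = k - 1 ∨ j = k - 1 - 1 ∨ j = k - 1 - 1 - 1 := by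
      clear * -
      revert j k
      decide
    rcases this with rfl | rfl | rfl | rfl
    exacts [le_rfl, h₁, h₁.trans h₂, (h₁.trans h₂).trans h₃]
  exact hi ((hall i).trans (hall 3).symm)

lemma tetrahedron_bounds {s x y z : ℝ} (hss : s * s = 2) (hs1 : 1.41 < s) (hs2 : s < 1.42)
    (h₀ : 0 ≤ 3 - s + (s - 3) * x + (s - 2) * y + (2 * s - 3) * z)
    (h₁ : 0 ≤ s + (3 - 2 * s) * x - s * y + (1 - s) * z)
    (h₂ : 0 ≤ 1 + (s - 1) * x + (2 - s) * y - z)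
    (h₃ : 0 ≤ x + s * y + (3 - s) * z) :
    (-(15 / 8) ≤ x ∧ x ≤ 15 / 8) ∧ (-(15 / 8) ≤ y ∧ y ≤ 15 / 8) ∧
      (-(15 / 8) ≤ z ∧ z ≤ 15 / 8) := by
  have hs0 : 0 ≤ s := by linarith
  set L₀ := 3 - s + (s - 3) * x + (s - 2) * y + (2 * s - 3) * z with hL₀
  set L₁ := s + (3 - 2 * s) * x - s * y + (1 - s) * z with hL₁
  set L₂ := 1 + (s - 1) * x + (2 - s) * y - z with hL₂
  set L₃ := x + s * y + (3 - s) * z with hL₃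
  have hsum : L₀ + L₁ + L₂ + L₃ = 4 := by rw [hL₀, hL₁, hL₂, hL₃]; ring
  have hx : 4 * x = (1 + s) - (1 + s) * L₀ + L₁ := by
    rw [hL₀, hL₁]; linear_combination (x + y + 2 * z - 1) * hss
  have hy : 4 * y = (1 + s) - (1 + s) * L₁ + L₂ := by
    rw [hL₁, hL₂]; linear_combination (1 - 2 * x - y - z) * hss
  have hz : 4 * z = (1 + s) - (1 + s) * L₂ + L₃ := by
    rw [hL₂, hL₃]; linear_combination (x - y) * hss
  refine ⟨⟨?_, ?_⟩, ⟨?_, ?_⟩, ?_, ?_⟩ <;>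
    nlinarith [mul_nonneg hs0 h₀, mul_nonneg hs0 h₁, mul_nonneg hs0 h₂,
      mul_nonneg hs0 h₃]

lemma tetrahedron_hollow {s : ℝ} {x y z : ℤ} (hss : s * s = 2) (hs1 : 1.41 < s) (hs2 : s < 1.42)
    (h₀ : 0 < 3 - s + (s - 3) * x + (s - 2) * y + (2 * s - 3) * z)
    (h₁ : 0 < s + (3 - 2 * s) * x - s * y + (1 - s) * z)
    (h₂ : 0 < 1 + (s - 1) * x + (2 - s) * y - z)
    (h₃ : 0 < (x : ℝ) + s * y + (3 - s) * z) : False := by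
  obtain ⟨⟨hx₁, hx₂⟩, ⟨hy₁, hy₂⟩, hz₁, hz₂⟩ :=
    tetrahedron_bounds hss hs1 hs2 h₀.le h₁.le h₂.le h₃.le
  have key (k : ℤ) (h₁ : -(15 / 8) ≤ (k : ℝ)) (h₂ : (k : ℝ) ≤ 15 / 8) : -2 < k ∧ k < 2 :=
    ⟨by exact_mod_cast (by linarith : (-2 : ℝ) < k), by exact_mod_cast (by linarith : (k : ℝ) < 2)⟩
  obtain ⟨hx₃, hx₄⟩ := key x hx₁ hx₂
  obtain ⟨hy₃, hy₄⟩ := key y hy₁ hy₂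
  obtain ⟨hz₃, hz₄⟩ := key z hz₁ hz₂
  clear hx₁ hx₂ hy₁ hy₂ hz₁ hz₂ key
  interval_cases x <;> interval_cases y <;> interval_cases z <;>
    push_cast at h₀ h₁ h₂ h₃ <;> linarith

/-- The Codenotti–Santos tetrahedron. -/
lemma hasHollowBody_three : HasHollowBody (Fin 3) (2 + √2) := by
  set s := √2 with hs
  have hss : s * s = 2 := Real.mul_self_sqrt (by norm_num)
  have hs0 : 0 < s := Real.sqrt_pos.2 (by norm_num)
  have hs1 : 1.41 < s := by nlinarith
  have hs2 : s < 1.42 := by nlinarith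
  let b := (1 + s) / 4
  let V : Fin 4 → Fin 3 → ℝ :=
    ![![-3 * b, b, b], ![1 + b, -3 * b, b], ![b, 1 + b, -3 * b], ![b, b, 1 + b]]
  let A : Fin 4 → Fin 3 → ℝ :=
    ![![s - 3, s - 2, 2 * s - 3], ![3 - 2 * s, -s, 1 - s], ![s - 1, 2 - s, -1], ![1, s, 3 - s]]
  let c : Fin 4 → ℝ := ![3 - s, s, 1, 0]
  have hV (k j) : 0 ≤ c j + ∑ i, A j i * V k i := by
    fin_cases k <;> fin_cases j <;> simp [A, c, V, b, Fin.sum_univ_succ] <;> nlinarith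
  refine hasHollowBody_of_polytope (M := 2) A c ?_ ?_ ?_ ?_ ?_
  · intro j h
    have := congrFun h 1
    fin_cases j <;> simp [A] at this <;> linarith
  · intro p hp
    simp [A, c, Fin.forall_fin_succ, Fin.sum_univ_succ] at hp ⊢
    obtain ⟨h₁, h₂, h₃⟩ := tetrahedron_bounds hss hs1 hs2
      (x := p 0) (y := p 1) (z := p 2) (by linarith) (by linarith) (by linarith)
      (by linarith)
    exact ⟨abs_le.2 ⟨by linarith, by linarith⟩, abs_le.2 ⟨by linarith, by linarith⟩,
      abs_le.2 ⟨by linarith, by linarith⟩⟩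
  · exact ⟨![1 / 4, 1 / 4, 1 / 4], by
      simp [A, c, Fin.forall_fin_succ, Fin.sum_univ_succ]
      refine ⟨?_, ?_, ?_, ?_⟩ <;> linarith⟩
  · intro z hz
    simp [A, c, Fin.forall_fin_succ, Fin.sum_univ_succ] at hz
    exact tetrahedron_hollow hss hs1 hs2 (x := z 0) (y := z 1) (z := z 2) (by linarith)
      (by linarith) (by linarith) (by linarith)
  · intro F hF
    let G : Fin 4 → ℤ := ![F 0, F 1, F 2, 0]
    have hG : ∃ i, G i ≠ G 3 := by
      by_contra! h
      exact hF (by ext i; fin_cases i; exacts [h 0, h 1, h 2])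
    have hval (k) : ∑ i, (F i : ℝ) * V k i =
        b * (F 0 + F 1 + F 2) + G (k - 1) - (1 + s) * G k := by
      fin_cases k <;> simp [V, G, b, Fin.sum_univ_succ] <;> ring
    obtain ⟨i, hi, hi'⟩ := exists_isMax_pred_lt hG
    obtain ⟨j, hj, hj'⟩ := exists_isMax_pred_lt (F := -G) (by simpa using hG)
    refine ⟨V j, hV j, V i, hV i, ?_⟩
    rw [hval, hval]
    have h₁ : (G (i - 1) : ℝ) + 1 ≤ G i := by exact_mod_cast hi'
    have h₂ : (G j : ℝ) + 1 ≤ G (j - 1) := by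
      simp only [Pi.neg_apply] at hj'
      exact_mod_cast (by lia : G j + 1 ≤ G (j - 1))
    have h₃ : (G j : ℝ) + 1 ≤ G i := by
      have := hi (j - 1)
      simp only [Pi.neg_apply] at hj'
      exact_mod_cast (by lia : G j + 1 ≤ G i)
    nlinarith

lemma hasHollowBody_succ (d : ℕ) : HasHollowBody (Fin (d + 1)) 1 := by
  induction d with
  | zero => exact hasHollowBody_one
  | succ d ih => exact (ih.add one_pos one_pos hasHollowBody_one).mono (by norm_num)

lemma wc_add_ofReal_le {d k : ℕ} {a : ℝ} (hd : 0 < d) (ha : 0 < a)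
    (h : HasHollowBody (Fin k) a) : wc d + ENNReal.ofReal a ≤ wc (d + k) := by
  have key (w : ℝ) (hw : HasHollowBody (Fin d) w) :
      ENNReal.ofReal w + ENNReal.ofReal a ≤ wc (d + k) := by
    have hw' : HasHollowBody (Fin d) (max w 1) := by
      rcases max_choice w 1 with h | h <;> rw [h]
      · exact hw
      · obtain ⟨e, rfl⟩ := Nat.exists_eq_succ_of_ne_zero hd.ne'
        exact hasHollowBody_succ e
    calc ENNReal.ofReal w + ENNReal.ofReal a
        ≤ ENNReal.ofReal (max w 1) + ENNReal.ofReal a := by gcongr; exact le_max_left _ _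
      _ = ENNReal.ofReal (max w 1 + a) := (ENNReal.ofReal_add (by positivity) ha.le).symm
      _ ≤ wc (d + k) := (hw'.add (by positivity) ha h).ofReal_le_wc (by lia)
  have hle : ENNReal.ofReal a ≤ wc (d + k) := by
    obtain ⟨e, rfl⟩ := Nat.exists_eq_succ_of_ne_zero hd.ne'
    exact le_add_self.trans (key 1 (hasHollowBody_succ e))
  rw [← tsub_add_cancel_of_le hle]
  gcongr
  exact iSup_le fun K => iSup_le fun h₁ => iSup_le fun h₂ => iSup_le fun h₃ => iSup_le fun h₄ =>
    ENNReal.le_sub_of_add_le_right ENNReal.ofReal_ne_top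
      (key _ (hasHollowBody_latticeWidth h₁ h₂ h₃ h₄))

theorem wc_additive_lower_bounds :
    (∀ d : ℕ, 0 < d →
      wc d + 1 ≤ wc (d + 1) ∧
      wc d + ENNReal.ofReal (1 + 2 / Real.sqrt 3) ≤ wc (d + 2) ∧
      wc d + ENNReal.ofReal (2 + Real.sqrt 2) ≤ wc (d + 3)) ∧
    (∀ d : ℕ, 2 ≤ d →
      ENNReal.ofReal ((1 / 2 + 1 / Real.sqrt 3) * (d : ℝ)) ≤ wc d) := by
  have h₁ := hasHollowBody_two
  have h₂ := hasHollowBody_three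
  have hadd (d : ℕ) (hd : 0 < d) :
      wc d + ENNReal.ofReal (1 + 2 / Real.sqrt 3) ≤ wc (d + 2) :=
    wc_add_ofReal_le hd (by positivity) h₁
  refine ⟨fun d hd => ⟨?_, hadd d hd, wc_add_ofReal_le hd (by positivity) h₂⟩, fun d hd => ?_⟩
  · simpa using wc_add_ofReal_le hd one_pos hasHollowBody_one
  · induction d using Nat.twoStepInduction with
    | zero => lia
    | one => lia
    | more d ih _ =>
      rcases Nat.lt_or_ge d 2 with hlt | hge
      · interval_cases d
        · refine le_trans (ENNReal.ofReal_le_ofReal (le_of_eq ?_)) (h₁.ofReal_le_wc two_pos)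
          push_cast
          ring
        · refine le_trans (ENNReal.ofReal_le_ofReal ?_) (h₂.ofReal_le_wc three_pos)
          have hs : (1.4 : ℝ) ≤ √2 := Real.le_sqrt_of_sq_le (by norm_num)
          have hq : (1.7 : ℝ) ≤ √3 := Real.le_sqrt_of_sq_le (by norm_num)
          have : 1 / √3 ≤ 1 / 1.7 := one_div_le_one_div_of_le (by norm_num) hq
          norm_num at this ⊢
          linarith
      · refine le_trans ?_ (hadd d (by lia))
        refine le_trans (le_of_eq ?_) (add_le_add_left (ih hge) _)
        rw [← ENNReal.ofReal_add (by positivity) (by positivity)]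
        congr 1
        push_cast
        ring
end
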